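/- Fix a real number p with 0 < p ≤ 1. There exists δ₀ > 0 such that for every real δ with 0 < δ < δ₀ and every real ε > 0 there exists an integer n₀ with the following property: for all integers n₁ ≥ n₂ ≥ n₃ > n₀, the probability that the binomial random graph G(⌈(8+δ)n₁⌉, p) arrows (C_{2n₁+1}, C_{2n₂+1}, C_{2n₃+1}) is at least 1 − ε. -/

import Mathlib

-- Probability, under the binomial random graph model `G(N,p)`, of a set of graphs
-- on the vertex set `Fin N`: each possible edge is present independently with probability `p`.
open Classical in
noncomputable def graphProbability (N : ℕ) (p : ℝ) (E : Set (SimpleGraph (Fin N))) : ℝ :=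
  ∑ G : SimpleGraph (Fin N),
    if G ∈ E then p ^ (Nat.card G.edgeSet) * (1 - p) ^ (N.choose 2 - Nat.card G.edgeSet) else 0

/-- `F` has a cycle of length `m`, all of whose edges get color `i` under `c`. -/
def HasMonoCycle {V : Type*} (F : SimpleGraph V) {k : ℕ} (c : F.edgeSet → Fin k)
    (i : Fin k) (m : ℕ) : Prop :=
  ∃ (v : V) (w : F.Walk v v), w.IsCycle ∧ w.length = m ∧
    ∀ e (h : e ∈ w.edges), c ⟨e, w.edges_subset_edgeSet h⟩ = i

/-- `F → (C_{n 0}, …, C_{n (k-1)})`: every `k`-coloring of the edges of `F` yields,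
for some color `i`, a cycle on `n i` vertices all of whose edges have color `i`. -/
def ArrowsCycles {V : Type*} (F : SimpleGraph V) {k : ℕ} (n : Fin k → ℕ) : Prop :=
  ∀ c : F.edgeSet → Fin k, ∃ i : Fin k, HasMonoCycle F c i (n i)


/-- The factor by which a vertex of cover value `c` counts in a component that is kept as it is
(`σ = 0`), restricted to one side (`σ = 1`), or restricted to the other side (`σ = 2`). -/
def stateWeight (b : Prop) [Decidable b] (c : ℕ) (σ : Fin 3) : ℕ :=
  if σ = 0 then 1 else if σ = 1 then 2 - c else if b then c else 0

open Classical in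
theorem card_le_of_three_covers {V κ : Type*} [Fintype V] [Fintype κ]
    (adj : Fin 3 → V → V → Prop) (comp : Fin 3 → V → κ) (bip : Fin 3 → κ → Prop)
    (c : Fin 3 → V → ℕ) (n m : ℕ) (hc : ∀ i v, c i v ≤ 2)
    (hcomp : ∀ i u v, adj i u v → comp i u = comp i v)
    (hcov : ∀ i u v, adj i u v → 2 ≤ c i u + c i v)
    (hbip : ∀ i u v, adj i u v → bip i (comp i u) → c i u + c i v = 2)
    (hbip1 : ∀ i u, bip i (comp i u) → c i u ≠ 1)
    (hsum : ∀ i x, ¬ bip i x → ∑ u with comp i u = x, c i u ≤ n)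
    (hmiss : ∀ v, Finset.card {u | ∀ i, ¬ adj i v u} ≤ m) :
    Fintype.card V ≤ 4 * n + 8 * m := by
  rcases isEmpty_or_nonempty V with hV | hV
  · simp
  let f : (Fin 3 → κ → Fin 3) → Fin 3 → V → ℕ := fun s i v =>
    stateWeight (bip i (comp i v)) (c i v) (s i (comp i v))
  let w : (Fin 3 → κ → Fin 3) → V → ℕ := fun s v => ∏ i, f s i v
  let W : (Fin 3 → κ → Fin 3) → ℕ := fun s => ∑ v, w s v
  let cnt : (Fin 3 → κ → Fin 3) → ℕ := fun s =>
    Finset.card {q : Fin 3 × κ | s q.1 q.2 ≠ 0}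
  obtain ⟨s, hs⟩ := Finite.exists_max (fun s => toLex (W s, cnt s))
  have hs1 : ∀ s', W s' ≤ W s := by
    intro s'
    have := hs s'
    rw [Prod.Lex.toLex_le_toLex] at this
    rcases this with h | h
    · exact h.le
    · exact h.1.le
  have hs2 : ∀ s', cnt s < cnt s' → W s' < W s := by
    intro s' h'
    have := hs s'
    rw [Prod.Lex.toLex_le_toLex] at this
    rcases this with h | h
    · exact h
    · simp only at h; omega
  have hN : Fintype.card V ≤ W s := by
    refine le_trans (le_of_eq ?_) (hs1 (fun _ _ => 0))
    simp [W, w, f, stateWeight]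
  have hf2 : ∀ i v, f s i v ≤ 2 := by
    intro i v
    have := hc i v
    simp only [f, stateWeight]
    split_ifs <;> omega
  let g : Fin 3 → V → ℕ := fun i v => ∏ j ∈ Finset.univ.erase i, f s j v
  have hwg : ∀ i v, w s v = f s i v * g i v := fun i v =>
    (Finset.mul_prod_erase _ _ (Finset.mem_univ i)).symm
  -- local optimality
  have hloc : ∀ i x, s i x = 0 → ∀ y : Fin 3, y ≠ 0 →
      ∑ v with comp i v = x, stateWeight (bip i x) (c i v) y * g i v
        < ∑ v with comp i v = x, g i v := by
    intro i x h0 y hy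
    let s' := Function.update s i (Function.update (s i) x y)
    have hcnt : cnt s < cnt s' := by
      refine Finset.card_lt_card ⟨?_, ?_⟩
      · intro q
        simp only [Finset.mem_filter, Finset.mem_univ, true_and, s']
        rcases q with ⟨j, z⟩
        by_cases hj : j = i
        · subst hj
          by_cases hz : z = x
          · subst hz; simp [hy]
          · simp [hz]
        · simp [hj]
      · intro h
        have := @h (i, x) (by simp [s', hy])
        simp [h0] at this
    have hlt := hs2 s' hcnt
    have hw1 : ∀ v, comp i v = x → w s' v = stateWeight (bip i x) (c i v) y * g i v := by
      intro v hv
      have : w s' v = f s' i v * ∏ j ∈ Finset.univ.erase i, f s' j v :=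
        (Finset.mul_prod_erase _ _ (Finset.mem_univ i)).symm
      rw [this]
      congr 1
      · simp [f, s', hv]
      · refine Finset.prod_congr rfl fun j hj => ?_
        have : j ≠ i := (Finset.mem_erase.1 hj).1
        simp [f, s', this]
    have hw2 : ∀ v, comp i v ≠ x → w s' v = w s v := by
      intro v hv
      refine Finset.prod_congr rfl fun j _ => ?_
      by_cases hj : j = i
      · subst hj; simp [f, s', hv]
      · simp [f, s', hj]
    have hw3 : ∀ v, comp i v = x → w s v = g i v := by
      intro v hv
      rw [hwg i v]; simp [f, hv, h0, stateWeight]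
    have e1 := Finset.sum_filter_add_sum_filter_not Finset.univ (fun v => comp i v = x) (w s')
    have e2 := Finset.sum_filter_add_sum_filter_not Finset.univ (fun v => comp i v = x) (w s)
    have e3 : ∑ v with ¬ comp i v = x, w s' v = ∑ v with ¬ comp i v = x, w s v :=
      Finset.sum_congr rfl fun v hv => hw2 v (Finset.mem_filter.1 hv).2
    have e4 : ∑ v with comp i v = x, w s' v =
        ∑ v with comp i v = x, stateWeight (bip i x) (c i v) y * g i v :=
      Finset.sum_congr rfl fun v hv => hw1 v (Finset.mem_filter.1 hv).2
    have e5 : ∑ v with comp i v = x, w s v = ∑ v with comp i v = x, g i v :=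
      Finset.sum_congr rfl fun v hv => hw3 v (Finset.mem_filter.1 hv).2
    simp only [W] at hlt
    omega
  have hstate0 : ∀ i x, s i x = 0 → ¬ bip i x ∧
      ∑ v with comp i v = x, g i v ≤ ∑ v with comp i v = x, c i v * g i v := by
    intro i x h0
    have h1 := hloc i x h0 1 (by decide)
    have key : ∑ v with comp i v = x, stateWeight (bip i x) (c i v) 1 * g i v +
        ∑ v with comp i v = x, c i v * g i v = 2 * ∑ v with comp i v = x, g i v := by
      rw [← Finset.sum_add_distrib, Finset.mul_sum]
      refine Finset.sum_congr rfl fun v _ => ?_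
      have := hc i v
      rw [← add_mul]
      congr 1
      simp [stateWeight]; omega
    refine ⟨fun hb => ?_, by omega⟩
    have h2 := hloc i x h0 2 (by decide)
    have : ∑ v with comp i v = x, stateWeight (bip i x) (c i v) 2 * g i v
        = ∑ v with comp i v = x, c i v * g i v :=
      Finset.sum_congr rfl fun v _ => by simp [stateWeight, hb]
    omega
  obtain ⟨v, hv⟩ := Finite.exists_max (w s)
  have hv0 : 0 < w s v := by
    by_contra h
    have : W s = 0 := Finset.sum_eq_zero fun u _ => by have := hv u; omega
    have := Fintype.card_pos (α := V)
    omega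
  have hf0 : ∀ i, f s i v ≠ 0 := by
    intro i h
    rw [hwg i v, h] at hv0
    simp at hv0
  have hnb : ∀ i, ∑ u with adj i v u, w s u ≤ if f s i v = 1 then w s v * n else 0 := by
    intro i
    have hsub : ∀ F : V → ℕ, ∑ u with adj i v u, F u ≤ ∑ u with comp i u = comp i v, F u := by
      intro F
      refine Finset.sum_le_sum_of_subset fun u hu => ?_
      simp only [Finset.mem_filter, Finset.mem_univ, true_and] at hu ⊢
      exact (hcomp i v u hu).symm
    have hcsum : ¬ bip i (comp i v) → (∀ u, adj i v u → w s u ≤ w s v * c i u) →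
        ∑ u with adj i v u, w s u ≤ w s v * n := by
      intro hb h
      calc ∑ u with adj i v u, w s u ≤ ∑ u with adj i v u, w s v * c i u :=
            Finset.sum_le_sum fun u hu => h u (Finset.mem_filter.1 hu).2
        _ ≤ ∑ u with comp i u = comp i v, w s v * c i u := hsub _
        _ = w s v * ∑ u with comp i u = comp i v, c i u := by rw [Finset.mul_sum]
        _ ≤ _ := Nat.mul_le_mul_left _ (hsum i _ hb)
    have hst : s i (comp i v) = 0 ∨ s i (comp i v) = 1 ∨ s i (comp i v) = 2 := by
      generalize s i (comp i v) = z
      revert z; decide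
    rcases hst with h0 | h1 | h2
    · have hfv : f s i v = 1 := by simp [f, h0, stateWeight]
      obtain ⟨hb, hle⟩ := hstate0 i _ h0
      rw [if_pos hfv]
      have hgw : ∀ u, comp i u = comp i v → g i u = w s u := by
        intro u hu
        rw [hwg i u]; simp [f, hu, h0, stateWeight]
      calc ∑ u with adj i v u, w s u ≤ ∑ u with comp i u = comp i v, w s u := hsub _
        _ = ∑ u with comp i u = comp i v, g i u :=
          Finset.sum_congr rfl fun u hu => (hgw u (Finset.mem_filter.1 hu).2).symm
        _ ≤ ∑ u with comp i u = comp i v, c i u * g i u := hle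
        _ ≤ ∑ u with comp i u = comp i v, c i u * w s v :=
          Finset.sum_le_sum fun u hu => by
            rw [hgw u (Finset.mem_filter.1 hu).2]
            exact Nat.mul_le_mul_left _ (hv u)
        _ = w s v * ∑ u with comp i u = comp i v, c i u := by
          rw [← Finset.sum_mul, mul_comm]
        _ ≤ _ := Nat.mul_le_mul_left _ (hsum i _ hb)
    · have hfu : ∀ u, comp i u = comp i v → f s i u = 2 - c i u := by
        intro u hu; simp [f, hu, h1, stateWeight]
      have hfv := hfu v rfl
      have hcv : c i v ≤ 1 := by have := hf0 i; omega
      have hzero : ∀ u, comp i u = comp i v → c i u = 2 → w s u = 0 := by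
        intro u hu h2; rw [hwg i u, hfu u hu, h2]; simp
      rcases Nat.eq_zero_or_pos (c i v) with hc0 | hc1
      · rw [if_neg (by omega)]
        refine le_of_eq (Finset.sum_eq_zero fun u hu => ?_)
        have hu := (Finset.mem_filter.1 hu).2
        have := hcov i v u hu
        have := hc i u
        exact hzero u (hcomp i v u hu).symm (by omega)
      · have hc1 : c i v = 1 := by omega
        rw [if_pos (by omega)]
        refine hcsum (fun hb => hbip1 i v hb hc1) fun u hu => ?_
        have := hcov i v u hu
        calc w s u ≤ w s v := hv u
          _ = w s v * 1 := (mul_one _).symm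
          _ ≤ w s v * c i u := Nat.mul_le_mul_left _ (by omega)
    · have hfu : ∀ u, comp i u = comp i v → f s i u = if bip i (comp i v) then c i u else 0 := by
        intro u hu; simp [f, hu, h2, stateWeight]
      have hb : bip i (comp i v) := by
        by_contra hb
        have := hfu v rfl
        rw [if_neg hb] at this
        exact hf0 i this
      have hfv := hfu v rfl
      rw [if_pos hb] at hfv
      have h3 := hbip1 i v hb
      have h4 := hf0 i
      have h5 := hc i v
      rw [if_neg (by omega)]
      refine le_of_eq (Finset.sum_eq_zero fun u hu => ?_)
      have hu := (Finset.mem_filter.1 hu).2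
      have h6 := hbip i v u hu hb
      have h7 := hfu u (hcomp i v u hu).symm
      rw [if_pos hb] at h7
      rw [hwg i u, h7, show c i u = 0 by omega, zero_mul]
  have hw8 : ∀ u, w s u ≤ 8 := by
    intro u
    calc w s u ≤ ∏ _i : Fin 3, 2 := Finset.prod_le_prod' fun i _ => hf2 i u
      _ = 8 := by simp
  have hcoverAll : W s ≤ ∑ i, ∑ u with adj i v u, w s u +
      ∑ u with ∀ i, ¬ adj i v u, w s u := by
    have e2 := Finset.sum_filter_add_sum_filter_not Finset.univ (fun u => ∀ i, ¬ adj i v u) (w s)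
    have : ∑ u with ¬ (∀ i, ¬ adj i v u), w s u ≤ ∑ i, ∑ u with adj i v u, w s u := by
      simp only [Finset.sum_filter]
      rw [Finset.sum_comm]
      refine Finset.sum_le_sum fun u _ => ?_
      by_cases h : ∀ i, ¬ adj i v u
      · rw [if_neg (not_not.2 h)]
        exact Nat.zero_le _
      · rw [if_pos h]
        push Not at h
        obtain ⟨i, hi⟩ := h
        refine le_trans (le_of_eq (if_pos hi).symm)
          (Finset.single_le_sum (f := fun i => if adj i v u then w s u else 0)
            (fun _ _ => Nat.zero_le _) (Finset.mem_univ i))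
    simp only [W]
    omega
  have hmissW : ∑ u with ∀ i, ¬ adj i v u, w s u ≤ 8 * m := by
    calc _ ≤ ∑ u with ∀ i, ¬ adj i v u, 8 := Finset.sum_le_sum fun u _ => hw8 u
      _ = Finset.card {u | ∀ i, ¬ adj i v u} * 8 := by simp
      _ ≤ _ := by have := hmiss v; omega
  have hfin : ∑ i, ∑ u with adj i v u, w s u ≤ 4 * n := by
    refine le_trans (Finset.sum_le_sum fun i _ => hnb i) ?_
    have hw : w s v = f s 0 v * f s 1 v * f s 2 v := Fin.prod_univ_three _
    rw [Fin.sum_univ_three, hw]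
    have h12 : ∀ i, f s i v = 1 ∨ f s i v = 2 := by
      intro i; have := hf0 i; have := hf2 i v; omega
    rcases h12 0 with h0 | h0 <;> rcases h12 1 with h1 | h1 <;> rcases h12 2 with h2 | h2 <;>
      rw [h0, h1, h2] <;> norm_num <;> omega
  omega

theorem exists_isCycle_of_seq {V : Type*} (G : SimpleGraph V) (v : ℕ → V) (L : ℕ) (hL : 3 ≤ L)
    (hinj : ∀ i j, i < L → j < L → v i = v j → i = j)
    (hadj : ∀ j, j + 1 < L → G.Adj (v j) (v (j + 1))) (hclose : G.Adj (v (L - 1)) (v 0)) :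
    ∃ (u : V) (w : G.Walk u u), w.IsCycle ∧ w.length = L := by
  have key : ∀ j, j < L → ∃ p : G.Walk (v 0) (v j), p.support = (List.range (j + 1)).map v ∧
      p.edges = (List.range j).map fun i => s(v i, v (i + 1)) := by
    intro j
    induction j with
    | zero => intro _; exact ⟨.nil, by simp, by simp⟩
    | succ j ih =>
      intro hj
      obtain ⟨p, h1, h2⟩ := ih (by omega)
      refine ⟨p.concat (hadj j hj), ?_, ?_⟩
      · rw [SimpleGraph.Walk.support_concat, h1, List.range_succ (n := j + 1)]; simp
      · rw [SimpleGraph.Walk.edges_concat, h2, List.range_succ (n := j)]; simp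
  obtain ⟨p, h1, h2⟩ := key (L - 1) (by omega)
  refine ⟨_, .cons hclose p, ?_, ?_⟩
  · rw [SimpleGraph.Walk.cons_isCycle_iff, SimpleGraph.Walk.isPath_def, h1, h2]
    constructor
    · refine List.Nodup.map_on ?_ List.nodup_range
      intro i hi j hj h
      rw [List.mem_range] at hi hj
      exact hinj i j (by omega) (by omega) h
    · intro h
      obtain ⟨i, hi, h⟩ := List.mem_map.1 h
      rw [List.mem_range] at hi
      rw [Sym2.eq_iff] at h
      rcases h with ⟨h, -⟩ | ⟨h, h'⟩
      · have := hinj _ _ (by omega) (by omega) h; omega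
      · have := hinj _ _ (by omega) (by omega) h
        have := hinj _ _ (by omega) (by omega) h'; omega
  · have := p.length_support
    rw [h1] at this
    simp at this
    simp; omega

open Classical in
/-- A closed walk in a reduced graph that visits no cluster too often lifts to a cycle. -/
theorem exists_cycle_of_closed_seq {V ι : Type*} (G : SimpleGraph V)
    (R : SimpleGraph ι) (C : ι → Finset V) (hdisj : ∀ a b, a ≠ b → Disjoint (C a) (C b))
    (s t B : ℕ) (hst : t ≤ s) (ht : 0 < t)
    (hgood : ∀ a b, R.Adj a b → ∀ X ⊆ C a, ∀ Y ⊆ C b, t ≤ X.card → s ≤ Y.card →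
      ∃ x ∈ X, t ≤ (Y.filter (G.Adj x)).card)
    (hedge : ∀ a b, R.Adj a b → ∀ X ⊆ C a, ∀ Y ⊆ C b, t ≤ X.card → t ≤ Y.card →
      ∃ x ∈ X, ∃ y ∈ Y, G.Adj x y)
    (hC : ∀ a, B + s + s + s ≤ (C a).card)
    (c : ℕ → ι) (L : ℕ) (hL : 3 ≤ L) (hc : ∀ j, j + 1 < L → R.Adj (c j) (c (j + 1)))
    (hclose : R.Adj (c (L - 1)) (c 0))
    (hB : ∀ a, ((Finset.range L).filter fun j => c j = a).card ≤ B) :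
    ∃ (u : V) (w : G.Walk u u), w.IsCycle ∧ w.length = L := by
  obtain ⟨Y, hYC, hYs⟩ := Finset.exists_subset_card_eq
    (show s ≤ (C (c (L - 1))).card by have := hC (c (L - 1)); omega)
  -- vertices used so far, inside one cluster
  have hused : ∀ (v : ℕ → V) (j : ℕ), j < L → (∀ i ≤ j, v i ∈ C (c i)) → ∀ a,
      s ≤ (C a \ (Y ∪ (Finset.range (j + 1)).image v)).card := by
    intro v j hj hv a
    have h1 : (C a ∩ (Finset.range (j + 1)).image v).card ≤ B := by
      refine le_trans (le_trans (Finset.card_le_card ?_)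
        (Finset.card_image_le (f := v))) (hB a)
      intro x hx
      obtain ⟨hx1, hx2⟩ := Finset.mem_inter.1 hx
      obtain ⟨i, hi, rfl⟩ := Finset.mem_image.1 hx2
      rw [Finset.mem_range] at hi
      refine Finset.mem_image_of_mem _ (Finset.mem_filter.2 ⟨Finset.mem_range.2 (by omega), ?_⟩)
      by_contra hne
      exact Finset.disjoint_left.1 (hdisj _ _ hne) (hv i (by omega)) hx1
    have h2 : C a \ (Y ∪ (Finset.range (j + 1)).image v) =
        C a \ ((C a ∩ Y) ∪ (C a ∩ (Finset.range (j + 1)).image v)) := by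
      ext x; simp only [Finset.mem_sdiff, Finset.mem_union, Finset.mem_inter]; tauto
    have h3 : (C a ∩ Y).card ≤ s := hYs ▸ Finset.card_le_card Finset.inter_subset_right
    have h4 := Finset.card_union_le (C a ∩ Y) (C a ∩ (Finset.range (j + 1)).image v)
    have h5 := Finset.le_card_sdiff ((C a ∩ Y) ∪ (C a ∩ (Finset.range (j + 1)).image v)) (C a)
    have := hC a
    rw [h2]; omega
  -- the starting vertex
  obtain ⟨v0, hv0, hv0Y, hv0F⟩ : ∃ v0 ∈ C (c 0) \ Y, t ≤ (Y.filter (G.Adj v0)).card ∧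
      t ≤ ((C (c 1) \ Y).filter (G.Adj v0)).card := by
    set X := (C (c 0) \ Y).filter fun x => t ≤ (Y.filter (G.Adj x)).card with hX
    have hX1 : ((C (c 0) \ Y).filter fun x => ¬ t ≤ (Y.filter (G.Adj x)).card).card < t := by
      by_contra! h
      obtain ⟨x, hx, hx'⟩ := hgood _ _ hclose.symm _
        ((Finset.filter_subset _ _).trans Finset.sdiff_subset) Y hYC h hYs.ge
      exact absurd hx' (not_le.2 (Finset.mem_filter.1 hx).2)
    have hX2 : X.card + ((C (c 0) \ Y).filter fun x => ¬ t ≤ (Y.filter (G.Adj x)).card).card =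
        (C (c 0) \ Y).card := by
      rw [hX]
      convert Finset.card_filter_add_card_filter_not (s := C (c 0) \ Y) _
    have hX3 := Finset.le_card_sdiff Y (C (c 0))
    have hX4 := hC (c 0)
    obtain ⟨x, hx, hx'⟩ := hgood _ _ (hc 0 (by omega)) X
      ((Finset.filter_subset _ _).trans Finset.sdiff_subset) (C (c 1) \ Y)
      Finset.sdiff_subset (by omega)
      (by have := Finset.le_card_sdiff Y (C (c 1)); have := hC (c 1); omega)
    exact ⟨x, (Finset.mem_filter.1 hx).1, (Finset.mem_filter.1 hx).2, hx'⟩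
  have hmain : ∀ j, j + 3 ≤ L → ∃ v : ℕ → V, v 0 = v0 ∧ (∀ i ≤ j, v i ∈ C (c i)) ∧
      (∀ i ≤ j, v i ∉ Y) ∧ (∀ i k, i ≤ j → k ≤ j → v i = v k → i = k) ∧
      (∀ i, i < j → G.Adj (v i) (v (i + 1))) ∧
      t ≤ ((C (c (j + 1)) \ (Y ∪ (Finset.range (j + 1)).image v)).filter (G.Adj (v j))).card := by
    intro j
    induction j with
    | zero =>
      intro _
      rw [Finset.mem_sdiff] at hv0
      refine ⟨fun _ => v0, rfl, ?_, ?_, by intros; omega, by intros; omega, ?_⟩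
      · intro i hi; obtain rfl : i = 0 := by omega
        exact hv0.1
      · intro i _; exact hv0.2
      · refine hv0F.trans (Finset.card_le_card ?_)
        intro x hx
        simp only [Finset.mem_filter, Finset.mem_sdiff] at hx
        have : x ≠ v0 := hx.2.ne'
        simp [hx, this]
    | succ j ih =>
      intro hj
      obtain ⟨v, h0, h1, h2, h3, h4, h5⟩ := ih (by omega)
      have hR := hc (j + 1) (by omega)
      obtain ⟨x, hx, hx'⟩ := hgood _ _ hR _
        ((Finset.filter_subset _ _).trans Finset.sdiff_subset)
        (C (c (j + 1 + 1)) \ (Y ∪ (Finset.range (j + 1)).image v)) Finset.sdiff_subset h5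
        (hused v j (by omega) h1 _)
      simp only [Finset.mem_filter, Finset.mem_sdiff, Finset.mem_union, Finset.mem_image,
        Finset.mem_range, not_or, not_exists, not_and] at hx
      obtain ⟨⟨hxC, hxY, hxv⟩, hxadj⟩ := hx
      have hu : ∀ i ≤ j, Function.update v (j + 1) x i = v i := fun i hi =>
        Function.update_of_ne (by omega) _ _
      have hu' : Function.update v (j + 1) x (j + 1) = x := Function.update_self _ _ _
      refine ⟨Function.update v (j + 1) x, ?_, ?_, ?_, ?_, ?_, ?_⟩
      · rw [hu 0 (by omega), h0]
      · intro i hi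
        rcases Nat.le_succ_iff.1 hi with hi | rfl
        · rw [hu i hi]; exact h1 i hi
        · rw [hu']; exact hxC
      · intro i hi
        rcases Nat.le_succ_iff.1 hi with hi | rfl
        · rw [hu i hi]; exact h2 i hi
        · rw [hu']; exact hxY
      · intro i k hi hk
        rcases Nat.le_succ_iff.1 hi with hi | rfl <;> rcases Nat.le_succ_iff.1 hk with hk | rfl
        · rw [hu i hi, hu k hk]; exact h3 i k hi hk
        · rw [hu i hi, hu']; intro h; exact absurd h (hxv i (by omega))
        · rw [hu k hk, hu']; intro h; exact absurd h.symm (hxv k (by omega))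
        · intro _; rfl
      · intro i hi
        rcases Nat.lt_succ_iff_lt_or_eq.1 hi with hi | rfl
        · rw [hu i hi.le, hu (i + 1) hi]; exact h4 i hi
        · rw [hu i le_rfl, hu']; exact hxadj
      · rw [hu']
        refine hx'.trans (Finset.card_le_card ?_)
        intro y hy
        simp only [Finset.mem_filter, Finset.mem_sdiff, Finset.mem_union, Finset.mem_image,
          Finset.mem_range, not_or, not_exists, not_and] at hy ⊢
        refine ⟨⟨hy.1.1, hy.1.2.1, ?_⟩, hy.2⟩
        intro i hi
        rcases Nat.lt_succ_iff_lt_or_eq.1 hi with hi | rfl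
        · rw [hu i (by omega)]; exact hy.1.2.2 i hi
        · rw [hu']; exact hy.2.ne
  obtain ⟨v, h0, h1, h2, h3, h4, h5⟩ := hmain (L - 3) (by omega)
  obtain ⟨x, hx, y, hy, hxy⟩ := hedge (c (L - 3 + 1)) (c (L - 1))
    (by have := hc (L - 3 + 1) (by omega); rwa [show L - 3 + 1 + 1 = L - 1 by omega] at this) _
    ((Finset.filter_subset _ _).trans Finset.sdiff_subset) (Y.filter (G.Adj v0))
    ((Finset.filter_subset _ _).trans hYC) h5 hv0Y
  simp only [Finset.mem_filter, Finset.mem_sdiff, Finset.mem_union, Finset.mem_image,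
        Finset.mem_range, not_or, not_exists, not_and] at hx hy
  obtain ⟨⟨hxC, hxY, hxv⟩, hxadj⟩ := hx
  obtain ⟨hyY, hyadj⟩ := hy
  let v' : ℕ → V := fun i => if i ≤ L - 3 then v i else if i = L - 2 then x else y
  have e1 : ∀ i ≤ L - 3, v' i = v i := fun i hi => if_pos hi
  have e2 : v' (L - 2) = x := by simp only [v']; rw [if_neg (by omega)]; simp
  have e3 : v' (L - 1) = y := by simp only [v']; rw [if_neg (by omega), if_neg (by omega)]
  have hsplit : ∀ i < L, i ≤ L - 3 ∨ i = L - 2 ∨ i = L - 1 := by omega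
  refine exists_isCycle_of_seq G v' L hL ?_ ?_ ?_
  · intro i k hi hk
    rcases hsplit i hi with hi | rfl | rfl <;> rcases hsplit k hk with hk | rfl | rfl
    · rw [e1 i hi, e1 k hk]; exact h3 i k hi hk
    · rw [e1 i hi, e2]; intro h; exact absurd h (hxv i (by omega))
    · rw [e1 i hi, e3]; intro h; exact absurd (h ▸ hyY) (h2 i hi)
    · rw [e1 k hk, e2]; intro h; exact absurd h.symm (hxv k (by omega))
    · intro _; rfl
    · rw [e2, e3]; intro h; exact absurd (h ▸ hyY) hxY
    · rw [e1 k hk, e3]; intro h; exact absurd (h ▸ hyY) (h2 k hk)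
    · rw [e2, e3]; intro h; exact absurd (h ▸ hyY) hxY
    · intro _; rfl
  · intro i hi
    rcases hsplit (i + 1) hi with hi' | hi' | hi'
    · rw [e1 i (by omega), e1 _ hi']; exact h4 i (by omega)
    · rw [e1 i (by omega), hi', e2, show i = L - 3 by omega]; exact hxadj
    · rw [hi', e3, show i = L - 2 by omega, e2]; exact hxy
  · rw [e3, e1 0 (by omega), h0]; exact hyadj.symm

section Walks
open Classical in
theorem SimpleGraph.Walk.exists_insert_excursion {ι : Type*} {R : SimpleGraph ι} {o : ι}
    (w : R.Walk o o) {a b : ι} (h : R.Adj a b) (ha : a ∈ w.support) (q : ℕ) :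
    ∃ w' : R.Walk o o, w'.length = w.length + 2 * q ∧ ∀ x, w'.support.count x =
      w.support.count x + (if a = x then q else 0) + (if b = x then q else 0) := by
  induction q with
  | zero => exact ⟨w, by simp, by simp⟩
  | succ q ih =>
    obtain ⟨w', h1, h2⟩ := ih
    have ha' : a ∈ w'.support := by
      rw [← List.count_pos_iff] at ha ⊢
      have := h2 a
      omega
    refine ⟨(w'.takeUntil a ha').append (.cons h (.cons h.symm (w'.dropUntil a ha'))), ?_, ?_⟩
    · have := congrArg SimpleGraph.Walk.length (w'.take_spec ha')
      rw [SimpleGraph.Walk.length_append] at this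
      rw [SimpleGraph.Walk.length_append, SimpleGraph.Walk.length_cons,
        SimpleGraph.Walk.length_cons]
      omega
    · intro x
      have := congrArg (fun p => p.support.count x) (w'.take_spec ha')
      simp only [SimpleGraph.Walk.support_append, List.count_append] at this
      have h3 := h2 x
      have h4 : (w'.dropUntil a ha').support.count x =
          (w'.dropUntil a ha').support.tail.count x + if a = x then 1 else 0 := by
        conv_lhs => rw [← SimpleGraph.Walk.cons_tail_support]
        rw [List.count_cons]; simp
      simp only [SimpleGraph.Walk.support_append, List.count_append, SimpleGraph.Walk.support_cons,
        List.tail_cons, List.count_cons, h4]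
      simp only [beq_iff_eq]
      split_ifs at * <;> omega

open Classical in
theorem SimpleGraph.Walk.exists_insert_excursions {ι : Type*} {R : SimpleGraph ι} {o : ι}
    (w : R.Walk o o) (Q : ℕ) (A : Finset (ι × ι)) (hA : ∀ e ∈ A, R.Adj e.1 e.2 ∧ e.1 ∈ w.support)
    (T : ℕ) (hT : T ≤ A.card * Q) :
    ∃ w' : R.Walk o o, w'.length = w.length + 2 * T ∧ ∀ x, w.support.count x ≤ w'.support.count x ∧
      w'.support.count x ≤
      w.support.count x + ((A.filter fun e => e.1 = x).card + (A.filter fun e => e.2 = x).card) * Q := by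
  induction A using Finset.induction_on generalizing T with
  | empty => exact ⟨w, by simp at hT; simp [hT], by simp⟩
  | insert e A he ih =>
    rw [Finset.card_insert_of_notMem he, add_mul, one_mul] at hT
    obtain ⟨w₁, h1, h2⟩ := ih (fun e' he' => hA e' (Finset.mem_insert_of_mem he'))
      (T - min T Q) (by omega)
    obtain ⟨hR, hm⟩ := hA e (Finset.mem_insert_self _ _)
    have hm' : e.1 ∈ w₁.support := by
      rw [← List.count_pos_iff] at hm ⊢
      have := h2 e.1
      omega
    obtain ⟨w₂, h3, h4⟩ := w₁.exists_insert_excursion hR hm' (min T Q)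
    refine ⟨w₂, by omega, fun x => ?_⟩
    have h5 := h2 x
    have h6 := h4 x
    have hq : min T Q ≤ Q := min_le_right _ _
    rw [Finset.filter_insert, Finset.filter_insert]
    refine ⟨by omega, ?_⟩
    have he1 : e ∉ A.filter fun e => e.1 = x := fun h => he (Finset.mem_filter.1 h).1
    have he2 : e ∉ A.filter fun e => e.2 = x := fun h => he (Finset.mem_filter.1 h).1
    have k1 : (if e.1 = x then insert e (A.filter fun e => e.1 = x) else
        (A.filter fun e => e.1 = x)).card = (A.filter fun e => e.1 = x).card +
        if e.1 = x then 1 else 0 := by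
      split_ifs
      · rw [Finset.card_insert_of_notMem he1]
      · rfl
    have k2 : (if e.2 = x then insert e (A.filter fun e => e.2 = x) else
        (A.filter fun e => e.2 = x)).card = (A.filter fun e => e.2 = x).card +
        if e.2 = x then 1 else 0 := by
      split_ifs
      · rw [Finset.card_insert_of_notMem he2]
      · rfl
    rw [k1, k2]
    split_ifs at * <;> simp only [add_mul, one_mul, zero_mul] at * <;> omega

theorem SimpleGraph.Reachable.dist_lt_fintypeCard {ι : Type*} [Fintype ι] {R : SimpleGraph ι}
    {u v : ι} (h : R.Reachable u v) : R.dist u v < Fintype.card ι := by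
  obtain ⟨p, hp, hl⟩ := h.exists_path_of_dist
  rw [← hl]; exact hp.length_lt

theorem SimpleGraph.exists_even_closed_walk_covering {ι : Type*} [Fintype ι]
    (R : SimpleGraph ι) (o : ι) (S : Finset ι) (hS : ∀ a ∈ S, R.Reachable o a) :
    ∃ w : R.Walk o o, Even w.length ∧ w.length ≤ 2 * Fintype.card ι * S.card ∧
      ∀ a ∈ S, a ∈ w.support := by
  classical
  induction S using Finset.induction_on with
  | empty => exact ⟨.nil, by simp, by simp, by simp⟩
  | insert a S ha ih =>
    obtain ⟨w, h1, h2, h3⟩ := ih fun b hb => hS b (Finset.mem_insert_of_mem hb)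
    have hr := hS a (Finset.mem_insert_self _ _)
    obtain ⟨p, hp⟩ := hr.exists_walk_length_eq_dist
    have := hr.dist_lt_fintypeCard
    refine ⟨(p.append p.reverse).append w, ?_, ?_, ?_⟩
    · simp only [SimpleGraph.Walk.length_append, SimpleGraph.Walk.length_reverse]
      exact Even.add ⟨_, rfl⟩ h1
    · simp only [SimpleGraph.Walk.length_append, SimpleGraph.Walk.length_reverse]
      rw [Finset.card_insert_of_notMem ha]
      rw [mul_add, mul_one]
      omega
    · intro b hb
      rw [SimpleGraph.Walk.mem_support_append_iff, SimpleGraph.Walk.mem_support_append_iff]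
      rcases Finset.mem_insert.1 hb with rfl | hb
      · exact Or.inl (Or.inl p.end_mem_support)
      · exact Or.inr (h3 b hb)

open Classical in
/-- In a non-bipartite component carrying `#A` arcs of a matching of the bipartite double cover,
there are closed walks of all odd lengths up to `2 * #A * Q` visiting no vertex often. -/
theorem SimpleGraph.exists_odd_closed_walk {ι : Type*} [Fintype ι] (R : SimpleGraph ι) (o u v : ι)
    (huv : R.Adj u v) (hu : R.Reachable o u) (hpar : R.dist o u % 2 = R.dist o v % 2)
    (A : Finset (ι × ι)) (hA : ∀ e ∈ A, R.Adj e.1 e.2 ∧ R.Reachable o e.1)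
    (hA1 : ∀ x, (A.filter fun e => e.1 = x).card ≤ 1)
    (hA2 : ∀ x, (A.filter fun e => e.2 = x).card ≤ 1) (Q L : ℕ) (hLodd : L % 2 = 1)
    (hL : 2 * Fintype.card ι * Fintype.card ι + 2 * Fintype.card ι + 1 ≤ L)
    (hLQ : L ≤ 2 * (A.card * Q)) :
    ∃ w : R.Walk o o, w.length = L ∧ ∀ x, w.support.count x ≤
      2 * Fintype.card ι * Fintype.card ι + 2 * Fintype.card ι + 2 + 2 * Q := by
  obtain ⟨w₁, h1, h2, h3⟩ := R.exists_even_closed_walk_covering o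
    (Finset.univ.filter fun a => R.Reachable o a) (by simp)
  have hv : R.Reachable o v := hu.trans huv.reachable
  obtain ⟨p, hp⟩ := hu.exists_walk_length_eq_dist
  obtain ⟨q, hq⟩ := hv.exists_walk_length_eq_dist
  have hp' := hu.dist_lt_fintypeCard
  have hq' := hv.dist_lt_fintypeCard
  set k := Fintype.card ι
  let w₂ : R.Walk o o := (p.append (.cons huv q.reverse)).append w₁
  have hl : w₂.length = R.dist o u + (R.dist o v + 1) + w₁.length := by
    simp [w₂, hp, hq]
  have hcard : 2 * k * (Finset.univ.filter fun a => R.Reachable o a).card ≤ 2 * k * k :=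
    Nat.mul_le_mul_left _ (Finset.card_le_univ _)
  have heven : w₁.length % 2 = 0 := Nat.even_iff.1 h1
  obtain ⟨w, hw, hw'⟩ := w₂.exists_insert_excursions Q A (fun e he => ⟨(hA e he).1, by
    rw [SimpleGraph.Walk.mem_support_append_iff]
    exact Or.inr (h3 _ (by simpa using (hA e he).2))⟩) ((L - w₂.length) / 2) (by omega)
  refine ⟨w, by omega, fun x => ?_⟩
  have h5 := (hw' x).2
  have h6 : w₂.support.count x ≤ w₂.length + 1 := by
    rw [← SimpleGraph.Walk.length_support]; exact List.count_le_length
  have h7 : ((A.filter fun e => e.1 = x).card + (A.filter fun e => e.2 = x).card) * Q ≤ 2 * Q :=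
    Nat.mul_le_mul_right _ (by have := hA1 x; have := hA2 x; omega)
  omega

open Classical in
theorem SimpleGraph.Walk.card_filter_getVert_le {ι : Type*} {R : SimpleGraph ι} {u v : ι}
    (w : R.Walk u v) (x : ι) :
    ((Finset.range w.length).filter fun j => w.getVert j = x).card ≤ w.support.count x := by
  induction w with
  | nil =>
    rw [SimpleGraph.Walk.length_nil, Finset.range_zero, Finset.filter_empty]
    exact Nat.zero_le _
  | @cons u v' v h p ih =>
    rw [SimpleGraph.Walk.support_cons, List.count_cons, SimpleGraph.Walk.length_cons,
      Finset.range_eq_Ico, ← Finset.insert_Ico_add_one_left_eq_Ico (by omega),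
      Finset.filter_insert]
    have : ((Finset.Ico (0 + 1) (p.length + 1)).filter
        fun j => (SimpleGraph.Walk.cons h p).getVert j = x).card ≤
        ((Finset.range p.length).filter fun j => p.getVert j = x).card := by
      rw [← Finset.card_image_of_injective
        ((Finset.range p.length).filter fun j => p.getVert j = x) (add_left_injective 1)]
      refine Finset.card_le_card fun j hj => ?_
      simp only [Finset.mem_filter, Finset.mem_Ico] at hj
      obtain ⟨i, rfl⟩ : ∃ i, j = i + 1 := ⟨j - 1, by omega⟩
      refine Finset.mem_image.2 ⟨i, ?_, rfl⟩
      rw [SimpleGraph.Walk.getVert_cons_succ] at hj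
      exact Finset.mem_filter.2 ⟨Finset.mem_range.2 (by omega), hj.2⟩
    simp only [SimpleGraph.Walk.getVert_zero, beq_iff_eq]
    split_ifs
    · exact (Finset.card_insert_le _ _).trans (by omega)
    · omega
end Walks

section Hall
open Classical in
/-- König duality for the bipartite double cover of a graph, restricted to a closed set `D`. -/
theorem exists_arcs_and_cover {ι : Type*} (R : SimpleGraph ι) (D : Finset ι)
    (hD : ∀ a b, R.Adj a b → a ∈ D → b ∈ D) :
    ∃ (c : ι → ℕ) (A : Finset (ι × ι)), (∀ a, c a ≤ 2) ∧
      (∀ a ∈ D, ∀ b, R.Adj a b → 2 ≤ c a + c b) ∧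
      (∀ e ∈ A, R.Adj e.1 e.2 ∧ e.1 ∈ D) ∧ (∀ x, (A.filter fun e => e.1 = x).card ≤ 1) ∧
      (∀ x, (A.filter fun e => e.2 = x).card ≤ 1) ∧ ∑ a ∈ D, c a = A.card := by
  let N : Finset ι → Finset ι := fun X => D.filter fun b => ∃ a ∈ X, R.Adj a b
  obtain ⟨X, hX, hmax⟩ := Finset.exists_max_image D.powerset (fun X => X.card + D.card - (N X).card)
    ⟨∅, by simp⟩
  rw [Finset.mem_powerset] at hX
  have hND : ∀ Y, (N Y).card ≤ D.card := fun Y => Finset.card_filter_le _ _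
  have hmax' : ∀ Y ⊆ D, Y.card + (N X).card ≤ X.card + (N Y).card := by
    intro Y hY
    have := hmax Y (Finset.mem_powerset.2 hY)
    have := hND X
    have := hND Y
    omega
  have hNX : (N X).card ≤ X.card := by
    have := hmax' ∅ (by simp)
    have h0 : N ∅ = ∅ := by simp [N]
    rw [h0] at this
    simpa using this
  set d := X.card - (N X).card with hd
  let t : D → Finset (ι ⊕ Fin d) := fun a => (N {a.1}).disjSum Finset.univ
  have hall : ∀ S : Finset D, S.card ≤ (S.biUnion t).card := by
    intro S
    rcases S.eq_empty_or_nonempty with rfl | hS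
    · simp
    have h1 : (N (S.image Subtype.val)).disjSum (Finset.univ : Finset (Fin d)) ⊆ S.biUnion t := by
      intro y hy
      rw [Finset.mem_biUnion]
      rcases y with y | y
      · rw [Finset.inl_mem_disjSum] at hy
        obtain ⟨hy1, a, ha, hay⟩ := Finset.mem_filter.1 hy
        obtain ⟨a', ha', rfl⟩ := Finset.mem_image.1 ha
        refine ⟨a', ha', ?_⟩
        rw [Finset.inl_mem_disjSum]
        exact Finset.mem_filter.2 ⟨hy1, a'.1, by simp, hay⟩
      · obtain ⟨a, ha⟩ := hS
        exact ⟨a, ha, by simp [t]⟩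
    have h2 := Finset.card_le_card h1
    rw [Finset.card_disjSum, Finset.card_univ, Fintype.card_fin] at h2
    have h3 := hmax' (S.image Subtype.val) (by
      intro x hx
      obtain ⟨a, -, rfl⟩ := Finset.mem_image.1 hx
      exact a.2)
    rw [Finset.card_image_of_injective _ Subtype.val_injective] at h3
    omega
  obtain ⟨f, hf, hft⟩ := (Finset.all_card_le_biUnion_card_iff_exists_injective t).1 hall
  let c : ι → ℕ := fun a => (if a ∈ X then 0 else 1) + if a ∈ N X then 1 else 0
  let A : Finset (ι × ι) := (D ×ˢ D).filter fun e => ∃ h : e.1 ∈ D, f ⟨e.1, h⟩ = Sum.inl e.2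
  have hA : ∀ e ∈ A, R.Adj e.1 e.2 ∧ e.1 ∈ D := by
    intro e he
    obtain ⟨h1, h2, h3⟩ := Finset.mem_filter.1 he
    have := hft ⟨e.1, h2⟩
    rw [h3, Finset.inl_mem_disjSum] at this
    obtain ⟨-, a, ha, hae⟩ := Finset.mem_filter.1 this
    rw [Finset.mem_singleton] at ha
    rw [ha] at hae
    exact ⟨hae, h2⟩
  have hA1 : ∀ x, (A.filter fun e => e.1 = x).card ≤ 1 := by
    intro x
    rw [Finset.card_le_one]
    rintro ⟨a, b⟩ h ⟨a', b'⟩ h'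
    simp only [A, Finset.mem_filter] at h h'
    obtain ⟨⟨-, _, h1⟩, rfl⟩ := h
    obtain ⟨⟨-, _, h2⟩, rfl⟩ := h'
    rw [h1] at h2
    rw [Sum.inl.inj h2]
  have hA2 : ∀ x, (A.filter fun e => e.2 = x).card ≤ 1 := by
    intro x
    rw [Finset.card_le_one]
    rintro ⟨a, b⟩ h ⟨a', b'⟩ h'
    simp only [A, Finset.mem_filter] at h h'
    obtain ⟨⟨-, _, h1⟩, rfl⟩ := h
    obtain ⟨⟨-, _, h2⟩, rfl⟩ := h'
    have := hf (h1.trans h2.symm)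
    simp at this
    rw [this]
  have hcov : ∀ a ∈ D, ∀ b, R.Adj a b → 2 ≤ c a + c b := by
    intro a ha b hab
    have hb := hD a b hab ha
    have h1 : a ∈ X → b ∈ N X := fun h => Finset.mem_filter.2 ⟨hb, a, h, hab⟩
    have h2 : b ∈ X → a ∈ N X := fun h => Finset.mem_filter.2 ⟨ha, b, h, hab.symm⟩
    simp only [c]
    by_cases h3 : a ∈ X <;> by_cases h4 : b ∈ X <;> simp [h1, h2, h3, h4]; omega
  have hsum : ∑ a ∈ D, c a = D.card - X.card + (N X).card := by
    have e1 : ∑ a ∈ D, (if a ∈ X then 0 else 1) = D.card - X.card := by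
      rw [← Finset.card_sdiff_of_subset hX]
      rw [Finset.card_eq_sum_ones, ← Finset.filter_notMem_eq_sdiff, Finset.sum_filter]
      exact Finset.sum_congr rfl fun a _ => by split_ifs <;> simp_all
    have e2 : ∑ a ∈ D, (if a ∈ N X then 1 else 0) = (N X).card := by
      rw [← Finset.sum_filter, ← Finset.card_eq_sum_ones, Finset.filter_mem_eq_inter,
        Finset.inter_eq_right.2 (Finset.filter_subset _ _)]
    simp only [c]
    rw [Finset.sum_add_distrib, e1, e2]
  have hXD := Finset.card_le_card hX
  -- `A` is large by Hall, and small by the cover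
  have hAge : D.card ≤ A.card + d := by
    have h1 : (Finset.univ : Finset D).card = D.card := by simp
    have h2 : (Finset.univ.image f : Finset (ι ⊕ Fin d)) ⊆
        (A.image Prod.snd).disjSum Finset.univ := by
      intro y hy
      obtain ⟨a, -, rfl⟩ := Finset.mem_image.1 hy
      rcases hfa : f a with b | b
      · rw [Finset.inl_mem_disjSum, Finset.mem_image]
        have := hft a
        rw [hfa, Finset.inl_mem_disjSum] at this
        exact ⟨(a.1, b), Finset.mem_filter.2 ⟨Finset.mem_product.2
          ⟨a.2, (Finset.mem_filter.1 this).1⟩, a.2, hfa⟩, rfl⟩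
      · simp
    have h3 := Finset.card_le_card h2
    rw [Finset.card_image_of_injective _ hf, h1, Finset.card_disjSum, Finset.card_univ,
      Fintype.card_fin] at h3
    have := Finset.card_image_le (s := A) (f := Prod.snd)
    omega
  have hAle : A.card ≤ D.card - X.card + (N X).card := by
    have h1 : A ⊆ (A.filter fun e => e.1 ∈ D \ X) ∪ (A.filter fun e => e.2 ∈ N X) := by
      intro e he
      obtain ⟨h, h'⟩ := hA e he
      rw [Finset.mem_union]
      by_cases hx : e.1 ∈ X
      · exact Or.inr (Finset.mem_filter.2 ⟨he, Finset.mem_filter.2 ⟨hD _ _ h h', e.1, hx, h⟩⟩)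
      · exact Or.inl (Finset.mem_filter.2 ⟨he, Finset.mem_sdiff.2 ⟨h', hx⟩⟩)
    have h2 : (A.filter fun e => e.1 ∈ D \ X).card ≤ (D \ X).card := by
      refine Finset.card_le_card_of_injOn Prod.fst (fun e he => (Finset.mem_filter.1 he).2) ?_
      intro e he e' he' h
      simp only [Finset.coe_filter, Set.mem_ofPred_eq] at he he'
      exact Finset.card_le_one.1 (hA1 e.1) e (Finset.mem_filter.2 ⟨he.1, rfl⟩) e'
        (Finset.mem_filter.2 ⟨he'.1, h.symm⟩)
    have h3 : (A.filter fun e => e.2 ∈ N X).card ≤ (N X).card := by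
      refine Finset.card_le_card_of_injOn Prod.snd (fun e he => (Finset.mem_filter.1 he).2) ?_
      intro e he e' he' h
      simp only [Finset.coe_filter, Set.mem_ofPred_eq] at he he'
      exact Finset.card_le_one.1 (hA2 e.2) e (Finset.mem_filter.2 ⟨he.1, rfl⟩) e'
        (Finset.mem_filter.2 ⟨he'.1, h.symm⟩)
    rw [Finset.card_sdiff_of_subset hX] at h2
    have := Finset.card_le_card h1
    have := Finset.card_union_le (A.filter fun e => e.1 ∈ D \ X) (A.filter fun e => e.2 ∈ N X)
    omega
  refine ⟨c, A, ?_, hcov, hA, hA1, hA2, ?_⟩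
  · intro a; simp only [c]; split_ifs <;> omega
  · rw [hsum]; omega
end Hall

section Weighting
open Classical in
/-- If `G` has no cycle of length `L`, then the components of a reduced graph `R` carry
half-integral vertex covers which are light on every non-bipartite component. -/
theorem exists_weighting_of_forall_cycle_length_ne {V ι : Type*} [Fintype ι] (G : SimpleGraph V)
    (R : SimpleGraph ι) (C : ι → Finset V) (hdisj : ∀ a b, a ≠ b → Disjoint (C a) (C b))
    (s t Q L : ℕ) (hst : t ≤ s) (ht : 0 < t)
    (hgood : ∀ a b, R.Adj a b → ∀ X ⊆ C a, ∀ Y ⊆ C b, t ≤ X.card → s ≤ Y.card →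
      ∃ x ∈ X, t ≤ (Y.filter (G.Adj x)).card)
    (hedge : ∀ a b, R.Adj a b → ∀ X ⊆ C a, ∀ Y ⊆ C b, t ≤ X.card → t ≤ Y.card →
      ∃ x ∈ X, ∃ y ∈ Y, G.Adj x y)
    (hC : ∀ a, 2 * Fintype.card ι * Fintype.card ι + 2 * Fintype.card ι + 2 + 2 * Q + s + s + s ≤
      (C a).card)
    (hLodd : L % 2 = 1) (hL3 : 3 ≤ L)
    (hL : 2 * Fintype.card ι * Fintype.card ι + 2 * Fintype.card ι + 1 ≤ L)
    (hcyc : ∀ (u : V) (w : G.Walk u u), w.IsCycle → w.length ≠ L) :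
    ∃ (comp : ι → ι) (bip : ι → Prop) (c : ι → ℕ), (∀ a, c a ≤ 2) ∧
      (∀ a b, R.Adj a b → comp a = comp b) ∧ (∀ a b, R.Adj a b → 2 ≤ c a + c b) ∧
      (∀ a b, R.Adj a b → bip (comp a) → c a + c b = 2) ∧ (∀ a, bip (comp a) → c a ≠ 1) ∧
      ∀ x, ¬ bip x → 2 * ((∑ a with comp a = x, c a) * Q) ≤ L := by
  let comp : ι → ι := fun a => (R.connectedComponentMk a).out
  have hreach : ∀ a, R.Reachable (comp a) a := fun a =>
    SimpleGraph.ConnectedComponent.exact (Quot.out_eq (R.connectedComponentMk a))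
  have hadj : ∀ a b, R.Adj a b → comp a = comp b := fun a b h => by
    simp only [comp]
    rw [SimpleGraph.ConnectedComponent.sound h.reachable]
  let bip : ι → Prop := fun x => ∀ u v, R.Adj u v → R.Reachable x u →
    R.dist x u % 2 ≠ R.dist x v % 2
  choose c A hc2 hcov hA hA1 hA2 hsum using fun x => exists_arcs_and_cover R
    (Finset.univ.filter fun a => comp a = x) (fun a b h ha => by
      simp only [Finset.mem_filter_univ] at ha ⊢
      rw [← hadj a b h, ha])
  refine ⟨comp, bip, fun a => if bip (comp a) then (if R.dist (comp a) a % 2 = 0 then 2 else 0)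
    else c (comp a) a, ?_, hadj, ?_, ?_, ?_, ?_⟩
  · intro a
    have := hc2 (comp a) a
    simp only
    split_ifs <;> omega
  · intro a b h
    simp only [← hadj a b h]
    by_cases hb : bip (comp a)
    · have := hb a b h (hreach a)
      simp only [hb, if_true]
      split_ifs <;> omega
    · simp only [hb, if_false]
      exact hcov (comp a) a (by simp) b h
  · intro a b h hb
    have := hb a b h (hreach a)
    simp only [← hadj a b h, hb, if_true]
    split_ifs <;> omega
  · intro a hb
    simp only [hb, if_true]
    split_ifs <;> omega
  · intro x hx
    have h1 : (∑ a with comp a = x, if bip (comp a) then (if R.dist (comp a) a % 2 = 0 then 2 else 0)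
        else c (comp a) a) = (A x).card := by
      rw [← hsum x]
      refine Finset.sum_congr rfl fun a ha => ?_
      rw [Finset.mem_filter_univ] at ha
      rw [ha, if_neg hx]
    rw [h1]
    by_contra hlt
    rw [not_le] at hlt
    simp only [bip] at hx
    push Not at hx
    obtain ⟨u, v, huv, hu, hpar⟩ := hx
    obtain ⟨w, hw, hcount⟩ := R.exists_odd_closed_walk x u v huv hu hpar (A x)
      (fun e he => ⟨(hA x e he).1, by
        have := (hA x e he).2
        rw [Finset.mem_filter_univ] at this
        rw [← this]
        exact hreach _⟩) (hA1 x) (hA2 x) Q L hLodd hL hlt.le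
    obtain ⟨y, w', hw', hl⟩ := exists_cycle_of_closed_seq G R C hdisj s t _ hst ht hgood hedge hC
      w.getVert L hL3 (fun j hj => w.adj_getVert_succ (by omega)) (by
        have := w.adj_getVert_succ (i := L - 1) (by omega)
        rw [show L - 1 + 1 = w.length by omega, w.getVert_length] at this
        rwa [w.getVert_zero]) (fun a => by
          rw [← hw]
          exact (w.card_filter_getVert_le a).trans (hcount a))
    exact hcyc y w' hw' hl
end Weighting

section Regularity
open Classical in
theorem SimpleGraph.IsUniform.lt_card_interedges {V : Type*} {G : SimpleGraph V} {A B X Y : Finset V}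
    {ε d : ℝ} (h : G.IsUniform ε A B) (hd : d ≤ G.edgeDensity A B) (hX : X ⊆ A) (hY : Y ⊆ B)
    (hXc : (A.card : ℝ) * ε ≤ X.card) (hYc : (B.card : ℝ) * ε ≤ Y.card) (hX0 : 0 < X.card)
    (hY0 : 0 < Y.card) : (d - ε) * (X.card * Y.card) < (G.interedges X Y).card := by
  have h1 := h hX hY hXc hYc
  rw [abs_lt] at h1
  have h2 : d - ε < G.edgeDensity X Y := by linarith [h1.1]
  have hX0' : (0 : ℝ) < X.card := by exact_mod_cast hX0
  have hY0' : (0 : ℝ) < Y.card := by exact_mod_cast hY0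
  rw [SimpleGraph.edgeDensity_def] at h2
  push_cast at h2
  rwa [lt_div_iff₀ (mul_pos hX0' hY0')] at h2

open Classical in
theorem SimpleGraph.card_interedges_eq_sum {V : Type*} (G : SimpleGraph V) (X Y : Finset V) :
    (G.interedges X Y).card = ∑ x ∈ X, (Y.filter (G.Adj x)).card := by
  rw [SimpleGraph.interedges_def, Finset.card_filter, Finset.sum_product]
  exact Finset.sum_congr rfl fun x _ => (Finset.card_filter _ _).symm

open Classical in
theorem SimpleGraph.IsUniform.exists_le_card_filter_adj {V : Type*} {G : SimpleGraph V}
    {A B X Y : Finset V} {ε d : ℝ} (h : G.IsUniform ε A B) (hd : d ≤ G.edgeDensity A B) (hX : X ⊆ A)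
    (hY : Y ⊆ B) (hXc : (A.card : ℝ) * ε ≤ X.card) (hYc : (B.card : ℝ) * ε ≤ Y.card)
    (hX0 : 0 < X.card) (hY0 : 0 < Y.card) {t : ℕ} (ht : (t : ℝ) ≤ (d - ε) * Y.card) :
    ∃ x ∈ X, t ≤ (Y.filter (G.Adj x)).card := by
  by_contra! hlt
  have h1 := h.lt_card_interedges hd hX hY hXc hYc hX0 hY0
  have h2 : (G.interedges X Y).card ≤ X.card * t := by
    rw [G.card_interedges_eq_sum, ← smul_eq_mul]
    exact Finset.sum_le_card_nsmul _ _ _ fun x hx => (hlt x hx).le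
  have h3 : ((G.interedges X Y).card : ℝ) ≤ X.card * t := by exact_mod_cast h2
  have h4 : (X.card : ℝ) * t ≤ X.card * ((d - ε) * Y.card) := by gcongr
  linarith

open Classical in
theorem SimpleGraph.IsUniform.exists_adj {V : Type*} {G : SimpleGraph V}
    {A B X Y : Finset V} {ε d : ℝ} (h : G.IsUniform ε A B) (hd : d ≤ G.edgeDensity A B) (hX : X ⊆ A)
    (hY : Y ⊆ B) (hXc : (A.card : ℝ) * ε ≤ X.card) (hYc : (B.card : ℝ) * ε ≤ Y.card)
    (hX0 : 0 < X.card) (hY0 : 0 < Y.card) (hεd : ε ≤ d) :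
    ∃ x ∈ X, ∃ y ∈ Y, G.Adj x y := by
  have h1 := h.lt_card_interedges hd hX hY hXc hYc hX0 hY0
  have h2 : (0 : ℝ) < (G.interedges X Y).card :=
    lt_of_le_of_lt (mul_nonneg (sub_nonneg.2 hεd) (by positivity)) h1
  obtain ⟨⟨x, y⟩, he⟩ := Finset.card_pos.1 (by exact_mod_cast h2 : 0 < (G.interedges X Y).card)
  rw [SimpleGraph.mem_interedges_iff] at he
  exact ⟨x, he.1, y, he.2.1, he.2.2⟩

open Classical in
/-- Szemerédi's regularity lemma, in the form of a reduced graph on boundedly many clusters which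
loses few edges. -/
theorem exists_reduced_graph (ε d η : ℝ) (hε : 0 < ε) (hd : 0 < d) (hη : 0 < η)
    (hsum : 4 * ε + η / 4 + 4 * d ≤ η) :
    ∃ M : ℕ, 0 < M ∧ ∀ (V : Type) [Fintype V], M ≤ Fintype.card V → ∀ G : SimpleGraph V,
      ∃ (ι : Type) (_ : Fintype ι) (R : SimpleGraph ι) (l : V → ι), 0 < Fintype.card ι ∧
        Fintype.card ι ≤ M ∧
        (∀ a, Fintype.card V / Fintype.card ι ≤ (Finset.univ.filter fun v => l v = a).card) ∧
        (∀ a, (Finset.univ.filter fun v => l v = a).card ≤ Fintype.card V / Fintype.card ι + 1) ∧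
        (∀ a b, R.Adj a b → G.IsUniform ε (Finset.univ.filter fun v => l v = a)
          (Finset.univ.filter fun v => l v = b) ∧ d ≤ G.edgeDensity
          (Finset.univ.filter fun v => l v = a) (Finset.univ.filter fun v => l v = b)) ∧
        ((Finset.univ.filter fun e : V × V => G.Adj e.1 e.2 ∧ ¬ R.Adj (l e.1) (l e.2)).card : ℝ) ≤
          η * (Fintype.card V) ^ 2 := by
  set q := ⌈8 / η⌉₊ with hq
  have hqpos : 0 < q := Nat.ceil_pos.2 (by positivity)
  have hbound : q ≤ SzemerediRegularity.bound ε q := SzemerediRegularity.le_bound _ _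
  refine ⟨SzemerediRegularity.bound ε q, hqpos.trans_le hbound, fun V _ hV G => ?_⟩
  obtain ⟨P, hP, hPq, hPM, hPu⟩ := szemeredi_regularity G hε (hbound.trans hV)
  have hpart : ∀ v, P.part v ∈ P.parts := fun v => P.part_mem.2 (Finset.mem_univ v)
  obtain ⟨l, hl⟩ : ∃ l : V → P.parts, ∀ v, (l v).1 = P.part v :=
    ⟨fun v => ⟨P.part v, hpart v⟩, fun v => rfl⟩
  obtain ⟨R, hR⟩ : ∃ R : SimpleGraph P.parts, ∀ a b, R.Adj a b ↔ a ≠ b ∧ G.IsUniform ε a.1 b.1 ∧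
      d ≤ G.edgeDensity a.1 b.1 := by
    refine ⟨⟨fun a b => a ≠ b ∧ G.IsUniform ε a.1 b.1 ∧ d ≤ G.edgeDensity a.1 b.1, ⟨?_⟩, ⟨?_⟩⟩,
      fun a b => Iff.rfl⟩
    · rintro a b ⟨h1, h2, h3⟩
      refine ⟨h1.symm, h2.symm, ?_⟩
      rwa [SimpleGraph.edgeDensity_comm]
    · rintro a ⟨h1, -⟩
      exact h1 rfl
  have hfib : ∀ (a : P.parts) [DecidablePred fun v => l v = a],
      (Finset.univ.filter fun v => l v = a) = a.1 := by
    intro a _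
    ext v
    rw [Finset.mem_filter_univ, Subtype.ext_iff, hl]
    constructor
    · rintro h
      have := P.mem_part (Finset.mem_univ v)
      rwa [h] at this
    · intro h
      exact P.part_eq_of_mem a.2 h
  have hcard : Fintype.card P.parts = P.parts.card := Fintype.card_coe _
  refine ⟨P.parts, inferInstance, R, l, ?_, ?_, ?_, ?_, ?_, ?_⟩
  · rw [hcard]; omega
  · rw [hcard]; exact hPM
  · intro a
    rw [hfib, hcard, ← Finset.card_univ]
    exact hP.average_le_card_part a.2
  · intro a
    rw [hfib, hcard, ← Finset.card_univ]
    exact hP.card_part_le_average_add_one a.2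
  · intro a b hab
    obtain ⟨-, h2, h3⟩ := (hR a b).1 hab
    rw [hfib, hfib]
    exact ⟨h2, h3⟩
  · have hne : (Finset.univ : Finset V).Nonempty := by
      rw [← Finset.card_pos, Finset.card_univ]; omega
    have hA := hP.sum_nonUniforms_lt hne hε hPu
    have hB := hP.card_biUnion_offDiag_le (ε := η / 2) (by positivity) (by
      have : (q : ℝ) ≤ P.parts.card := by exact_mod_cast hPq
      refine le_trans (le_trans (le_of_eq ?_) (Nat.le_ceil (8 / η))) this
      field_simp; norm_num)
    have hC := hP.card_interedges_sparsePairs_le (G := G) (ε := d) hd.le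
    rw [Finset.card_univ] at hA hB hC
    have hsub : ∀ x y, G.Adj x y → ¬ R.Adj (l x) (l y) →
        (x, y) ∈ (P.nonUniforms G ε).biUnion (fun (U, V) ↦ U ×ˢ V) ∪ P.parts.biUnion Finset.offDiag ∪
        (P.sparsePairs G d).biUnion fun (U, V) ↦ G.interedges U V := by
      intro x y hadj hn
      rw [hR, hl, hl] at hn
      have hx := P.mem_part (Finset.mem_univ x)
      have hy := P.mem_part (Finset.mem_univ y)
      rw [Finset.mem_union, Finset.mem_union, Finset.mem_biUnion, Finset.mem_biUnion,
        Finset.mem_biUnion]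
      by_cases h1 : P.part x = P.part y
      · refine Or.inl (Or.inr ⟨P.part x, hpart x, ?_⟩)
        rw [Finset.mem_offDiag]
        exact ⟨hx, h1 ▸ hy, hadj.ne⟩
      by_cases h2 : G.IsUniform ε (P.part x) (P.part y)
      · refine Or.inr ⟨(P.part x, P.part y), ?_, ?_⟩
        · rw [Finpartition.mk_mem_sparsePairs]
          refine ⟨hpart x, hpart y, h1, ?_⟩
          by_contra h3
          exact hn ⟨fun h => h1 (by rw [← hl, h, hl]), h2, not_lt.1 h3⟩
        · rw [SimpleGraph.mem_interedges_iff]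
          exact ⟨hx, hy, hadj⟩
      · refine Or.inl (Or.inl ⟨(P.part x, P.part y), ?_, Finset.mem_product.2 ⟨hx, hy⟩⟩)
        rw [Finpartition.mk_mem_nonUniforms]
        exact ⟨hpart x, hpart y, h1, h2⟩
    have hle := (Finset.card_union_le ((P.nonUniforms G ε).biUnion (fun (U, V) ↦ U ×ˢ V) ∪
      P.parts.biUnion Finset.offDiag) ((P.sparsePairs G d).biUnion fun (U, V) ↦ G.interedges U V)).trans
      (Nat.add_le_add_right (Finset.card_union_le _ _) _)
    refine le_trans (Nat.cast_le.2 (le_trans (Finset.card_le_card fun e he => ?_) hle)) ?_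
    · have he' := (Finset.mem_filter.1 he).2
      exact hsub e.1 e.2 he'.1 he'.2
    push_cast
    calc _ ≤ 4 * ε * (Fintype.card V : ℝ) ^ 2 + η / 2 / 2 * (Fintype.card V : ℝ) ^ 2 +
          4 * d * (Fintype.card V : ℝ) ^ 2 := add_le_add (add_le_add hA.le hB) hC
      _ = (4 * ε + η / 4 + 4 * d) * (Fintype.card V : ℝ) ^ 2 := by ring
      _ ≤ _ := by gcongr
end Regularity

section Structure
open Classical in
/-- The structure of a dense graph without cycles of a given odd length: up to few edges it is a
blow-up of a bounded graph with a vertex cover light on the non-bipartite components. -/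
theorem exists_structure_of_forall_cycle_length_ne (η : ℝ) (hη : 0 < η) (hη1 : η ≤ 1) :
    ∃ M K : ℕ, ∀ (V : Type) [Fintype V], K ≤ Fintype.card V → ∀ (G : SimpleGraph V) (L : ℕ),
      L % 2 = 1 → K ≤ L → (∀ (u : V) (w : G.Walk u u), w.IsCycle → w.length ≠ L) →
      ∃ (l : V → Fin M) (r : Fin M → Fin M → Prop) (comp : Fin M → Fin M) (bip : Fin M → Prop)
        (c : Fin M → ℕ), (∀ a, c a ≤ 2) ∧ (∀ a b, r a b → comp a = comp b) ∧
        (∀ a b, r a b → 2 ≤ c a + c b) ∧ (∀ a b, r a b → bip (comp a) → c a + c b = 2) ∧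
        (∀ a, bip (comp a) → c a ≠ 1) ∧
        (∀ x, ¬ bip x → ((∑ v with comp (l v) = x, c (l v) : ℕ) : ℝ) ≤
          L + η * Fintype.card V) ∧
        ((Finset.univ.filter fun e : V × V => G.Adj e.1 e.2 ∧ ¬ r (l e.1) (l e.2)).card : ℝ) ≤
          η * (Fintype.card V) ^ 2 := by
  set E : ℝ := η ^ 2 / 1024 with hE
  have hEpos : 0 < E := by positivity
  have hEη : E ≤ η / 1024 := by rw [hE]; nlinarith
  obtain ⟨M, hM, hred⟩ := exists_reduced_graph E (η / 16) η hEpos (by positivity) hη (by linarith)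
  set k₀ : ℕ := 2 * M * M + 2 * M + 2 with hk₀
  set m₀ : ℕ := ⌈1 + 1 / E⌉₊ + 2 * (k₀ + 3) with hm₀
  refine ⟨M, M * m₀ + ⌈4 * M * (k₀ + 5) / η⌉₊ + k₀ + 3, fun V _ hV G L hLodd hL hcyc => ?_⟩
  have hMm : M ≤ M * m₀ := Nat.le_mul_of_pos_right _ (by omega)
  obtain ⟨ι, _, R, l, hι0, hιM, hlow, hupp, hR, hfew⟩ := hred V (by omega) G
  set k := Fintype.card ι with hk
  set N := Fintype.card V with hN
  set m := N / k with hm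
  set C : ι → Finset V := fun a => Finset.univ.filter fun v => l v = a with hC
  have hmm₀ : m₀ ≤ m := by
    rw [hm, Nat.le_div_iff_mul_le hι0]
    calc m₀ * k ≤ m₀ * M := Nat.mul_le_mul_left _ hιM
      _ = M * m₀ := mul_comm _ _
      _ ≤ N := by omega
  have hkm : (k : ℝ) * m ≤ N := by
    exact_mod_cast (Nat.mul_div_le N k)
  have hmE : 1 + 1 / E ≤ m := by
    refine (Nat.le_ceil _).trans ?_
    exact_mod_cast (by omega : ⌈1 + 1 / E⌉₊ ≤ m)
  have hmE' : E + 1 ≤ E * m := by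
    have := mul_le_mul_of_nonneg_left hmE hEpos.le
    have h2 : E * (1 + 1 / E) = E + 1 := by field_simp
    linarith
  have hmk₀ : 2 * ((k₀ : ℝ) + 3) ≤ m := by
    exact_mod_cast (by omega : 2 * (k₀ + 3) ≤ m)
  set s := ⌈η * m / 16⌉₊ with hs
  set t := ⌈E * (m + 1)⌉₊ with ht
  have hs1 : η * m / 16 ≤ s := Nat.le_ceil _
  have hs2 : (s : ℝ) < η * m / 16 + 1 := Nat.ceil_lt_add_one (by positivity)
  have ht1 : E * (m + 1) ≤ t := Nat.le_ceil _
  have ht2 : (t : ℝ) < E * (m + 1) + 1 := Nat.ceil_lt_add_one (by positivity)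
  have htpos : 0 < t := Nat.ceil_pos.2 (by positivity)
  have hts' : (t : ℝ) ≤ (η / 16 - E) * s := by
    have h1 : η / 32 * (η * m / 16) = 2 * (E * m) := by rw [hE]; ring
    have h2 : η / 32 * (η * m / 16) ≤ (η / 16 - E) * s := by
      apply mul_le_mul (by linarith) hs1 (by positivity) (by linarith)
    linarith
  have hts : t ≤ s := by
    have : (t : ℝ) ≤ s := by
      refine hts'.trans ?_
      have : (0 : ℝ) ≤ s := by positivity
      nlinarith
    exact_mod_cast this
  have hk₁ : 2 * k * k + 2 * k + 2 ≤ k₀ := by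
    rw [hk₀]; gcongr
  have hfit : k₀ + 3 * s ≤ m := by
    have h1 : η * m ≤ m := by
      have : (0 : ℝ) ≤ m := by positivity
      nlinarith
    have : (k₀ : ℝ) + 3 * s ≤ m := by linarith
    exact_mod_cast this
  set Q := (m - k₀ - 3 * s) / 2 with hQ
  have hcardle : ∀ a (X : Finset V), t ≤ X.card → ((C a).card : ℝ) * E ≤ X.card := by
    intro a X hX
    have h1 : ((C a).card : ℝ) ≤ m + 1 := by exact_mod_cast hupp a
    have h2 : (t : ℝ) ≤ X.card := by exact_mod_cast hX
    nlinarith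
  obtain ⟨comp, bip, c, hc2, hcomp, hcov, hbip, hbip1, hsum⟩ :=
    exists_weighting_of_forall_cycle_length_ne G R C
      (fun a b hab => Finset.disjoint_left.2 fun v h1 h2 => hab (by
        rw [← (Finset.mem_filter.1 h1).2, (Finset.mem_filter.1 h2).2])) s t Q L hts htpos
      (fun a b hab X hX Y hY hXt hYs =>
        (hR a b hab).1.exists_le_card_filter_adj (hR a b hab).2 hX hY (hcardle a X hXt)
          (hcardle b Y (hts.trans hYs)) (by omega) (by omega) (hts'.trans (by
            have : (s : ℝ) ≤ Y.card := by exact_mod_cast hYs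
            exact mul_le_mul_of_nonneg_left this (by linarith))))
      (fun a b hab X hX Y hY hXt hYt =>
        (hR a b hab).1.exists_adj (hR a b hab).2 hX hY (hcardle a X hXt)
          (hcardle b Y hYt) (by omega) (by omega) (by linarith))
      (fun a => by rw [← hk]; exact le_trans (by omega) (hlow a)) hLodd (by omega)
      (by rw [← hk]; omega) hcyc
  have hweight : ∀ x, ¬ bip x → ((∑ v with comp (l v) = x, c (l v) : ℕ) : ℝ) ≤ L + η * N := by
    intro x hx
    have h1 : ∑ v with comp (l v) = x, c (l v) ≤ (∑ a with comp a = x, c a) * (m + 1) := by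
      rw [Finset.sum_mul, ← Finset.sum_fiberwise_of_maps_to
        (s := Finset.univ.filter fun v => comp (l v) = x)
        (t := Finset.univ.filter fun a => comp a = x) (g := l) (fun v hv => by
          rw [Finset.mem_filter_univ] at hv ⊢; exact hv)]
      refine Finset.sum_le_sum fun a ha => ?_
      calc _ ≤ ∑ v ∈ C a, c a := by
            refine (Finset.sum_congr rfl fun v hv => ?_).trans_le
              (Finset.sum_le_sum_of_subset (f := fun _ => c a) fun v hv => ?_)
            · rw [(Finset.mem_filter.1 hv).2]
            · rw [Finset.mem_filter_univ]
              exact (Finset.mem_filter.1 hv).2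
        _ = (C a).card * c a := by rw [Finset.sum_const, smul_eq_mul]
        _ ≤ _ := by rw [mul_comm]; exact Nat.mul_le_mul_left _ (hupp a)
    have h2 := hsum x hx
    have h3 : ∑ a with comp a = x, c a ≤ 2 * k := by
      refine (Finset.sum_le_card_nsmul _ _ 2 fun a _ => hc2 a).trans ?_
      rw [smul_eq_mul, mul_comm]
      exact Nat.mul_le_mul_left _ (Finset.card_le_univ _)
    set S := ∑ a with comp a = x, c a with hS
    have h4 : m + 1 ≤ 2 * Q + (k₀ + 3 * s + 2) := by omega
    have h5 : S * (m + 1) ≤ L + 2 * k * (k₀ + 3 * s + 2) := by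
      calc S * (m + 1) ≤ S * (2 * Q + (k₀ + 3 * s + 2)) := Nat.mul_le_mul_left _ h4
        _ = 2 * (S * Q) + S * (k₀ + 3 * s + 2) := by ring
        _ ≤ _ := Nat.add_le_add h2 (Nat.mul_le_mul_right _ h3)
    have h6 : ((∑ v with comp (l v) = x, c (l v) : ℕ) : ℝ) ≤
        L + 2 * k * (k₀ + 3 * s + 2) := by exact_mod_cast h1.trans h5
    refine h6.trans (add_le_add le_rfl ?_)
    have hkpos : (0 : ℝ) < k := by exact_mod_cast hι0
    have hkM : (k : ℝ) ≤ M := by exact_mod_cast hιM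
    have h7 : 2 * (k : ℝ) * (k₀ + 3 * s + 2) ≤ 2 * k * (k₀ + 5) + 3 / 8 * η * (k * m) := by
      have := mul_le_mul_of_nonneg_left hs2.le hkpos.le
      linarith
    have h8 : 2 * (k : ℝ) * (k₀ + 5) ≤ 2 * M * (k₀ + 5) := by gcongr
    have h9 : 4 * M * (k₀ + 5) / η ≤ N := by
      refine (Nat.le_ceil _).trans ?_
      exact_mod_cast (by omega : ⌈4 * M * (k₀ + 5) / η⌉₊ ≤ N)
    rw [div_le_iff₀ hη] at h9
    have h10 : 3 / 8 * η * (k * m) ≤ 3 / 8 * η * N := by gcongr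
    have h11 : 0 ≤ η * N := by positivity
    linarith
  -- transport to `Fin M`
  let j : ι → Fin M := fun a => Fin.castLE hιM (Fintype.equivFin ι a)
  have hj : Function.Injective j :=
    (Fin.castLE_injective hιM).comp (Fintype.equivFin ι).injective
  have : Nonempty ι := Fintype.card_pos_iff.1 hι0
  obtain ⟨g, hg⟩ := hj.hasLeftInverse
  refine ⟨j ∘ l, fun a b => R.Adj (g a) (g b), j ∘ comp ∘ g, bip ∘ g, c ∘ g, fun a => hc2 _,
    fun a b h => congrArg j (hcomp _ _ h), fun a b h => hcov _ _ h, fun a b h hb => ?_,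
    fun a hb => ?_, fun x hx => ?_, ?_⟩
  · refine hbip _ _ h ?_
    simpa [hg (comp (g a))] using hb
  · refine hbip1 _ ?_
    simpa [hg (comp (g a))] using hb
  · simp only [Function.comp_apply, hg (l _)] at hx ⊢
    by_cases hx' : ∃ y, j y = x
    · obtain ⟨y, rfl⟩ := hx'
      rw [hg y] at hx
      simp only [hj.eq_iff]
      exact hweight y hx
    · rw [Finset.sum_eq_zero]
      · rw [Nat.cast_zero]; positivity
      · intro v hv
        exact absurd ⟨_, (Finset.mem_filter.1 hv).2⟩ hx'
  · simp only [Function.comp_apply, hg (l _)]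
    exact hfew
end Structure

section RandomGraph
/-- The probability of a single graph in the binomial random graph. -/
noncomputable def graphWeight {N : ℕ} (p : ℝ) (G : SimpleGraph (Fin N)) : ℝ :=
  p ^ (Nat.card G.edgeSet) * (1 - p) ^ (N.choose 2 - Nat.card G.edgeSet)

theorem graphWeight_nonneg {N : ℕ} {p : ℝ} (hp0 : 0 ≤ p) (hp1 : p ≤ 1) (G : SimpleGraph (Fin N)) :
    0 ≤ graphWeight p G :=
  mul_nonneg (pow_nonneg hp0 _) (pow_nonneg (sub_nonneg.2 hp1) _)

open Classical in
theorem sum_graphWeight_mul_pow {N : ℕ} (p x : ℝ) (E : Finset (Sym2 (Fin N)))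
    (hE : E ⊆ (⊤ : SimpleGraph (Fin N)).edgeFinset) :
    ∑ G : SimpleGraph (Fin N), graphWeight p G * x ^ (G.edgeFinset ∩ E).card =
      (1 - p + p * x) ^ E.card := by
  set T := (⊤ : SimpleGraph (Fin N)).edgeFinset with hT
  have hTcard : T.card = N.choose 2 := by
    rw [hT, SimpleGraph.card_edgeFinset_top_eq_card_choose_two, Fintype.card_fin]
  have h1 : ∏ e ∈ T, (p * (if e ∈ E then x else 1) + (1 - p)) = (1 - p + p * x) ^ E.card := by
    have : ∀ e ∈ T, p * (if e ∈ E then x else 1) + (1 - p) = if e ∈ E then 1 - p + p * x else 1 := by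
      intro e _
      split_ifs <;> ring
    rw [Finset.prod_congr rfl this, Finset.prod_ite_mem, Finset.inter_eq_right.2 hE,
      Finset.prod_const]
  have hmem : ∀ (G : SimpleGraph (Fin N)) (e), e ∈ G.edgeFinset ↔ e ∈ G.edgeSet :=
    fun G e => SimpleGraph.mem_edgeFinset
  rw [← h1, Finset.prod_add]
  refine Finset.sum_bij' (fun G _ => G.edgeFinset)
    (fun S _ => SimpleGraph.fromEdgeSet (S : Set (Sym2 (Fin N)))) ?_ ?_ ?_ ?_ ?_
  · intro G _
    rw [Finset.mem_powerset]
    exact SimpleGraph.edgeFinset_mono le_top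
  · intro S _
    exact Finset.mem_univ _
  · intro G _
    simp
  · intro S hS
    rw [Finset.mem_powerset] at hS
    ext e
    rw [hmem, SimpleGraph.edgeSet_fromEdgeSet]
    refine ⟨fun h => h.1, fun h => ⟨h, ?_⟩⟩
    have := hS h
    rw [hT, SimpleGraph.mem_edgeFinset] at this
    exact SimpleGraph.not_isDiag_of_mem_edgeSet _ this
  · intro G _
    have hsub : G.edgeFinset ⊆ T := SimpleGraph.edgeFinset_mono le_top
    have hc : Nat.card G.edgeSet = G.edgeFinset.card := by
      rw [Nat.card_eq_fintype_card, SimpleGraph.edgeFinset_card]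
    rw [graphWeight, hc, Finset.prod_mul_distrib, Finset.prod_const, Finset.prod_const,
      Finset.card_sdiff_of_subset hsub, hTcard, Finset.prod_ite_mem, Finset.prod_const]
    ring

open Classical in
theorem sum_graphWeight {N : ℕ} (p : ℝ) : ∑ G : SimpleGraph (Fin N), graphWeight p G = 1 := by
  have := sum_graphWeight_mul_pow (N := N) p 1 ∅ (by simp)
  simpa using this

open Classical in
/-- Chernoff bound for the number of edges of the binomial random graph inside a set of pairs. -/
theorem sum_graphWeight_few_edges_le {N : ℕ} {p η : ℝ} (hp0 : 0 ≤ p) (hp1 : p ≤ 1)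
    (hN : 2 ≤ η * N) (B : Finset (Fin N × Fin N)) (hB : η * (N : ℝ) ^ 2 ≤ B.card) :
    ∑ G : SimpleGraph (Fin N), (if ((B.filter fun e => G.Adj e.1 e.2).card : ℝ) ≤
      p * η / 16 * (N : ℝ) ^ 2 then graphWeight p G else 0) ≤
      Real.exp (-(p * η / 16 * (N : ℝ) ^ 2)) := by
  set θ := p * η / 16 * (N : ℝ) ^ 2 with hθ
  have hη : 0 ≤ η := by
    by_contra h
    have : (0 : ℝ) ≤ N := by positivity
    nlinarith
  have hθ0 : 0 ≤ θ := by positivity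
  set E : Finset (Sym2 (Fin N)) := (B.filter fun e => e.1 ≠ e.2).image fun e => s(e.1, e.2) with hE
  have hET : E ⊆ (⊤ : SimpleGraph (Fin N)).edgeFinset := by
    intro e he
    obtain ⟨⟨a, b⟩, hab, rfl⟩ := Finset.mem_image.1 he
    rw [SimpleGraph.mem_edgeFinset, SimpleGraph.mem_edgeSet, SimpleGraph.top_adj]
    exact (Finset.mem_filter.1 hab).2
  have hdiag : (B.filter fun e => ¬ e.1 ≠ e.2).card ≤ N := by
    calc _ ≤ (Finset.univ : Finset (Fin N)).card := by
          refine Finset.card_le_card_of_injOn Prod.fst (fun e _ => Finset.mem_univ _) ?_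
          intro e he e' he' h
          have h1 := not_not.1 (Finset.mem_filter.1 he).2
          have h2 := not_not.1 (Finset.mem_filter.1 he').2
          exact Prod.ext h (by rw [← h1, ← h2, h])
      _ = N := by simp
  have hoff : (B.filter fun e => e.1 ≠ e.2).card ≤ E.card * 2 := by
    rw [hE, mul_comm]
    refine Finset.card_le_mul_card_image (f := fun e : Fin N × Fin N => s(e.1, e.2)) _ 2
      fun e _ => ?_
    induction e with | _ a b =>
    refine (Finset.card_le_card (t := ({(a, b), (b, a)} : Finset (Fin N × Fin N))) ?_).trans Finset.card_le_two
    rintro ⟨x, y⟩ hxy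
    have := (Finset.mem_filter.1 hxy).2
    rw [Sym2.eq_iff] at this
    rw [Finset.mem_insert, Finset.mem_singleton]
    rcases this with ⟨rfl, rfl⟩ | ⟨rfl, rfl⟩
    · exact Or.inl rfl
    · exact Or.inr rfl
  have hBcard : (B.card : ℝ) ≤ E.card * 2 + N := by
    have h := Finset.card_filter_add_card_filter_not (s := B) (fun e => e.1 ≠ e.2)
    have : B.card ≤ E.card * 2 + N := by omega
    exact_mod_cast this
  have hEcard : η * (N : ℝ) ^ 2 / 4 ≤ E.card := by
    have : (N : ℝ) ≤ η * (N : ℝ) ^ 2 / 2 := by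
      have h0 : (0 : ℝ) ≤ N := by positivity
      nlinarith
    linarith
  have hedges : ∀ G : SimpleGraph (Fin N), (G.edgeFinset ∩ E).card ≤
      (B.filter fun e => G.Adj e.1 e.2).card := by
    intro G
    refine (Finset.card_le_card (t := (B.filter fun e => G.Adj e.1 e.2).image
      fun e => s(e.1, e.2)) ?_).trans Finset.card_image_le
    intro e he
    obtain ⟨h1, h2⟩ := Finset.mem_inter.1 he
    obtain ⟨⟨a, b⟩, hab, rfl⟩ := Finset.mem_image.1 h2
    rw [SimpleGraph.mem_edgeFinset, SimpleGraph.mem_edgeSet] at h1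
    exact Finset.mem_image.2 ⟨(a, b), Finset.mem_filter.2 ⟨(Finset.mem_filter.1 hab).1, h1⟩, rfl⟩
  calc _ ≤ ∑ G : SimpleGraph (Fin N),
        Real.exp θ * (graphWeight p G * (1 / 2 : ℝ) ^ (G.edgeFinset ∩ E).card) := by
        refine Finset.sum_le_sum fun G _ => ?_
        have hw := graphWeight_nonneg hp0 hp1 G
        split_ifs with h
        · have h1 : (2 : ℝ) ^ (G.edgeFinset ∩ E).card ≤ Real.exp θ := by
            calc (2 : ℝ) ^ (G.edgeFinset ∩ E).card ≤ (Real.exp 1) ^ (G.edgeFinset ∩ E).card := by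
                  gcongr
                  have := Real.add_one_le_exp (1 : ℝ)
                  linarith
              _ = Real.exp ((G.edgeFinset ∩ E).card) := by
                  rw [← Real.exp_nat_mul, mul_one]
              _ ≤ _ := by
                  rw [Real.exp_le_exp]
                  refine le_trans ?_ h
                  exact_mod_cast hedges G
          have h2 : 1 ≤ Real.exp θ * (1 / 2 : ℝ) ^ (G.edgeFinset ∩ E).card := by
            rw [one_div, inv_pow, ← div_eq_mul_inv, le_div_iff₀ (by positivity), one_mul]
            exact h1
          nlinarith
        · positivity
    _ = Real.exp θ * (1 - p + p * (1 / 2)) ^ E.card := by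
        rw [← Finset.mul_sum, sum_graphWeight_mul_pow p _ E hET]
    _ ≤ Real.exp θ * (Real.exp (-(p / 2))) ^ E.card := by
        have h1 := Real.add_one_le_exp (-(p / 2))
        have h2 : 1 - p + p * (1 / 2) ≤ Real.exp (-(p / 2)) := by linarith
        have h3 : 0 ≤ 1 - p + p * (1 / 2) := by linarith
        gcongr
    _ = Real.exp (θ - p / 2 * E.card) := by
        rw [← Real.exp_nat_mul, ← Real.exp_add]
        ring_nf
    _ ≤ _ := by
        rw [Real.exp_le_exp]
        have : p / 2 * (η * (N : ℝ) ^ 2 / 4) ≤ p / 2 * E.card := by gcongr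
        rw [hθ]
        linarith

open Classical in
/-- With high probability, all block unions of bounded complexity which span few edges of the
binomial random graph are small. -/
theorem exists_forall_le_graphProbability (κ : Type) [Fintype κ] {p η ε : ℝ} (hp0 : 0 < p)
    (hp1 : p ≤ 1) (hη : 0 < η) (hε : 0 < ε) :
    ∃ N₀ : ℕ, ∀ N, N₀ ≤ N → ∀ S : Set (SimpleGraph (Fin N)),
      (∀ G : SimpleGraph (Fin N), (∀ (l : Fin N → κ) (b : κ → κ → Prop),
        ((Finset.univ.filter fun e : Fin N × Fin N => b (l e.1) (l e.2) ∧ G.Adj e.1 e.2).card : ℝ) ≤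
          p * η / 16 * (N : ℝ) ^ 2 →
        ((Finset.univ.filter fun e : Fin N × Fin N => b (l e.1) (l e.2)).card : ℝ) ≤
          η * (N : ℝ) ^ 2) → G ∈ S) → 1 - ε ≤ graphProbability N p S := by
  set q : ℝ := p * η / 16 with hq
  have hqpos : 0 < q := by positivity
  set F : ℕ := Fintype.card (κ → κ → Prop) with hF
  set k : ℕ := Fintype.card κ with hk
  refine ⟨⌈2 / η⌉₊ + ⌈(F + k + 1) / q⌉₊ + ⌈1 / ε⌉₊ + 1, fun N hN S hS => ?_⟩
  have hN1 : 2 ≤ η * N := by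
    have : 2 / η ≤ N := (Nat.le_ceil _).trans (by exact_mod_cast (by omega : ⌈2 / η⌉₊ ≤ N))
    rwa [div_le_iff₀ hη, mul_comm] at this
  have hN2 : (F + k + 1 : ℝ) ≤ q * N := by
    have : (F + k + 1) / q ≤ N :=
      (Nat.le_ceil _).trans (by exact_mod_cast (by omega : ⌈(F + k + 1) / q⌉₊ ≤ N))
    rwa [div_le_iff₀ hqpos, mul_comm] at this
  have hN3 : 1 ≤ ε * N := by
    have : 1 / ε ≤ N := (Nat.le_ceil _).trans (by exact_mod_cast (by omega : ⌈1 / ε⌉₊ ≤ N))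
    rwa [div_le_iff₀ hε, mul_comm] at this
  have hN4 : (1 : ℝ) ≤ N := by exact_mod_cast (by omega : 1 ≤ N)
  let B : (Fin N → κ) × (κ → κ → Prop) → Finset (Fin N × Fin N) :=
    fun x => Finset.univ.filter fun e => x.2 (x.1 e.1) (x.1 e.2)
  let bad : (Fin N → κ) × (κ → κ → Prop) → SimpleGraph (Fin N) → Prop := fun x G =>
    η * (N : ℝ) ^ 2 ≤ (B x).card ∧
      (((B x).filter fun e => G.Adj e.1 e.2).card : ℝ) ≤ q * (N : ℝ) ^ 2
  have hbad : ∀ x, ∑ G : SimpleGraph (Fin N), (if bad x G then graphWeight p G else 0) ≤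
      Real.exp (-(q * (N : ℝ) ^ 2)) := by
    intro x
    by_cases hx : η * (N : ℝ) ^ 2 ≤ (B x).card
    · refine le_trans (le_of_eq ?_) (sum_graphWeight_few_edges_le hp0.le hp1 hN1 (B x) hx)
      refine Finset.sum_congr rfl fun G _ => ?_
      simp only [bad, hx, true_and, hq]
    · simp only [bad, hx, false_and, if_false, Finset.sum_const_zero]
      positivity
  have hcover : ∀ G : SimpleGraph (Fin N), graphWeight p G ≤
      (if G ∈ S then graphWeight p G else 0) + ∑ x, if bad x G then graphWeight p G else 0 := by
    intro G
    have hw := graphWeight_nonneg hp0.le hp1 G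
    have hnn : ∀ x ∈ Finset.univ, 0 ≤ if bad x G then graphWeight p G else 0 := by
      intro x _
      split_ifs <;> simp [hw]
    by_cases hG : G ∈ S
    · rw [if_pos hG]
      linarith [Finset.sum_nonneg hnn]
    · rw [if_neg hG, zero_add]
      have : ∃ x, bad x G := by
        by_contra! hx
        refine hG (hS G fun l b h => ?_)
        by_contra hlt
        refine hx (l, b) ⟨(not_le.1 hlt).le, ?_⟩
        simpa only [B, Finset.filter_filter] using h
      obtain ⟨x, hx⟩ := this
      have := Finset.single_le_sum hnn (Finset.mem_univ x)
      rwa [if_pos hx] at this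
  have htotal := Finset.sum_le_sum fun G (_ : G ∈ Finset.univ) => hcover G
  rw [sum_graphWeight, Finset.sum_add_distrib, Finset.sum_comm] at htotal
  have hcount := Finset.sum_le_card_nsmul Finset.univ _ _ fun x (_ : x ∈ Finset.univ) => hbad x
  rw [Finset.card_univ, Fintype.card_prod, Fintype.card_fun, Fintype.card_fin, ← hF, ← hk,
    nsmul_eq_mul] at hcount
  have hsmall : ((k ^ N * F : ℕ) : ℝ) * Real.exp (-(q * (N : ℝ) ^ 2)) ≤ ε := by
    push_cast
    have h1 : (k : ℝ) ^ N ≤ Real.exp (k * N) := by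
      rw [mul_comm, Real.exp_nat_mul]
      gcongr
      linarith [Real.add_one_le_exp (k : ℝ)]
    have h2 : (F : ℝ) ≤ Real.exp F := by linarith [Real.add_one_le_exp (F : ℝ)]
    calc (k : ℝ) ^ N * F * Real.exp (-(q * (N : ℝ) ^ 2))
        ≤ Real.exp (k * N) * Real.exp F * Real.exp (-(q * (N : ℝ) ^ 2)) := by gcongr
      _ = Real.exp (k * N + F - q * (N : ℝ) ^ 2) := by
          rw [← Real.exp_add, ← Real.exp_add]; ring_nf
      _ ≤ Real.exp (-N) := by
          rw [Real.exp_le_exp]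
          have hF0 : (0 : ℝ) ≤ F := by positivity
          nlinarith
      _ ≤ ε := by
          rw [Real.exp_neg, inv_le_comm₀ (Real.exp_pos _) hε]
          have h3 := Real.add_one_le_exp (N : ℝ)
          have h4 : ε⁻¹ ≤ N := by
            rw [inv_le_iff_one_le_mul₀ hε, mul_comm]; exact hN3
          linarith
  have hprob : graphProbability N p S =
      ∑ G : SimpleGraph (Fin N), if G ∈ S then graphWeight p G else 0 := rfl
  rw [hprob]
  linarith
end RandomGraph

section Colouring
/-- The graph of the edges of colour `i`. -/
def SimpleGraph.colourGraph {V : Type*} (F : SimpleGraph V) {k : ℕ} (c : F.edgeSet → Fin k)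
    (i : Fin k) : SimpleGraph V where
  Adj u v := ∃ h : F.Adj u v, c ⟨s(u, v), h⟩ = i
  symm := ⟨fun u v ⟨h, hc⟩ => ⟨h.symm, by
    rw [← hc]
    exact congrArg c (Subtype.ext Sym2.eq_swap)⟩⟩
  loopless := ⟨fun u ⟨h, _⟩ => F.loopless.irrefl u h⟩

theorem SimpleGraph.colourGraph_le {V : Type*} (F : SimpleGraph V) {k : ℕ} (c : F.edgeSet → Fin k)
    (i : Fin k) : F.colourGraph c i ≤ F := fun _ _ h => h.1

theorem hasMonoCycle_of_isCycle_colourGraph {V : Type*} (F : SimpleGraph V) {k : ℕ}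
    (c : F.edgeSet → Fin k) (i : Fin k) {u : V} (w : (F.colourGraph c i).Walk u u)
    (hw : w.IsCycle) : HasMonoCycle F c i w.length := by
  refine ⟨u, w.mapLe (F.colourGraph_le c i), hw.mapLe _, by simp, fun e h => ?_⟩
  have h' : e ∈ (F.colourGraph c i).edgeSet := by
    rw [SimpleGraph.Walk.edges_mapLe_eq_edges] at h
    exact w.edges_subset_edgeSet h
  induction e with | _ a b =>
  obtain ⟨_, h2⟩ := h'
  exact h2

open Classical in
theorem card_le_of_three_covers_of_few_missing {V κ : Type*} [Fintype V] [Fintype κ]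
    (adj : Fin 3 → V → V → Prop) (comp : Fin 3 → V → κ) (bip : Fin 3 → κ → Prop)
    (c : Fin 3 → V → ℕ) (n τ : ℝ) (hτ : 0 < τ) (hn : 0 ≤ n) (hc : ∀ i v, c i v ≤ 2)
    (hcomp : ∀ i u v, adj i u v → comp i u = comp i v)
    (hcov : ∀ i u v, adj i u v → 2 ≤ c i u + c i v)
    (hbip : ∀ i u v, adj i u v → bip i (comp i u) → c i u + c i v = 2)
    (hbip1 : ∀ i u, bip i (comp i u) → c i u ≠ 1)
    (hsum : ∀ i x, ¬ bip i x → ((∑ u with comp i u = x, c i u : ℕ) : ℝ) ≤ n)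
    (hmiss : ((Finset.univ.filter fun e : V × V => ∀ i, ¬ adj i e.1 e.2).card : ℝ) ≤
      τ ^ 2 * (Fintype.card V) ^ 2) :
    (Fintype.card V : ℝ) ≤ 4 * n + 9 * τ * Fintype.card V := by
  set N := Fintype.card V with hN
  rcases Nat.eq_zero_or_pos N with h0 | hNpos
  · rw [h0]; simp [hn]
  have hNpos' : (0 : ℝ) < N := by exact_mod_cast hNpos
  let d : V → ℕ := fun v => (Finset.univ.filter fun u => ∀ i, ¬ adj i v u).card
  have hd : ∑ v, d v = (Finset.univ.filter fun e : V × V => ∀ i, ¬ adj i e.1 e.2).card := by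
    rw [Finset.card_filter, ← Finset.univ_product_univ, Finset.sum_product]
    exact Finset.sum_congr rfl fun v _ => Finset.card_filter _ _
  set W := Finset.univ.filter fun v => ¬ (d v : ℝ) ≤ τ * N with hW
  have hWcard : (W.card : ℝ) ≤ τ * N := by
    have h1 : (W.card : ℝ) * (τ * N) ≤ τ ^ 2 * N ^ 2 := by
      refine le_trans ?_ hmiss
      rw [← hd, ← nsmul_eq_mul]
      push_cast
      calc W.card • (τ * N) ≤ ∑ v ∈ W, (d v : ℝ) :=
            Finset.card_nsmul_le_sum _ _ _ fun v hv => (not_le.1 (Finset.mem_filter.1 hv).2).le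
        _ ≤ _ := Finset.sum_le_sum_of_subset_of_nonneg (Finset.subset_univ _)
            fun _ _ _ => by positivity
    have h2 : (0 : ℝ) < τ * N := by positivity
    refine le_of_mul_le_mul_right ?_ h2
    linarith
  have key := card_le_of_three_covers (V := {v // (d v : ℝ) ≤ τ * N})
    (fun i u v => adj i u.1 v.1) (fun i u => comp i u.1) bip (fun i u => c i u.1) ⌊n⌋₊ ⌊τ * N⌋₊
    (fun i u => hc i u.1) (fun i u v => hcomp i u.1 v.1) (fun i u v => hcov i u.1 v.1)
    (fun i u v => hbip i u.1 v.1) (fun i u => hbip1 i u.1) (fun i x hx => by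
      refine Nat.le_floor (le_trans ?_ (hsum i x hx))
      rw [Nat.cast_le]
      refine (Finset.sum_map (Finset.univ.filter fun u : {v // (d v : ℝ) ≤ τ * N} =>
        comp i u.1 = x) (Function.Embedding.subtype _) (fun v => c i v)).symm.le.trans
        (Finset.sum_le_sum_of_subset fun v hv => ?_)
      obtain ⟨u, hu, rfl⟩ := Finset.mem_map.1 hv
      exact Finset.mem_filter.2 ⟨Finset.mem_univ _, (Finset.mem_filter.1 hu).2⟩) (fun v => by
      refine Nat.le_floor (le_trans ?_ v.2)
      rw [Nat.cast_le, ← Finset.card_map (Function.Embedding.subtype _)]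
      refine Finset.card_le_card fun y hy => ?_
      obtain ⟨u, hu, rfl⟩ := Finset.mem_map.1 hy
      exact Finset.mem_filter.2 ⟨Finset.mem_univ _, (Finset.mem_filter.1 hu).2⟩)
  have hVW : N = Fintype.card {v // (d v : ℝ) ≤ τ * N} + W.card := by
    rw [Fintype.card_subtype, hW, Finset.card_filter_add_card_filter_not, Finset.card_univ]
  have h1 : ((⌊n⌋₊ : ℕ) : ℝ) ≤ n := Nat.floor_le hn
  have h2 : ((⌊τ * N⌋₊ : ℕ) : ℝ) ≤ τ * N := Nat.floor_le (by positivity)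
  have h3 : (Fintype.card {v // (d v : ℝ) ≤ τ * N} : ℝ) ≤ 4 * ⌊n⌋₊ + 8 * ⌊τ * N⌋₊ := by
    exact_mod_cast key
  have h4 : (N : ℝ) = Fintype.card {v // (d v : ℝ) ≤ τ * N} + W.card := by exact_mod_cast hVW
  linarith
end Colouring

theorem stmt0 (p : ℝ) (hp0 : 0 < p) (hp1 : p ≤ 1) :
    ∃ δ₀ : ℝ, 0 < δ₀ ∧ ∀ δ : ℝ, 0 < δ → δ < δ₀ → ∀ ε : ℝ, 0 < ε →
      ∃ n₀ : ℕ, ∀ n₁ n₂ n₃ : ℕ, n₂ ≤ n₁ → n₃ ≤ n₂ → n₀ < n₃ →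
        1 - ε ≤ graphProbability (⌈(8 + δ) * (n₁ : ℝ)⌉₊) p
          {G | ArrowsCycles G ![2 * n₁ + 1, 2 * n₂ + 1, 2 * n₃ + 1]} := by
  classical
  refine ⟨1, one_pos, fun δ hδ0 hδ1 ε hε => ?_⟩
  set τ : ℝ := δ / 400 with hτ
  have hτ0 : 0 < τ := by positivity
  set η : ℝ := p * τ ^ 2 / 48 with hη
  have hη0 : 0 < η := by positivity
  have hητ : η ≤ τ := by
    have h1 : p * τ ^ 2 ≤ 1 * τ ^ 2 := by gcongr
    have h2 : τ ^ 2 ≤ τ := by nlinarith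
    linarith
  obtain ⟨M, K, hstruct⟩ := exists_structure_of_forall_cycle_length_ne η hη0 (by linarith)
  obtain ⟨N₀, hprob⟩ := exists_forall_le_graphProbability (Fin 3 → Fin M) hp0 hp1
    (by positivity : 0 < τ ^ 2) hε
  refine ⟨K + N₀ + ⌈8 / δ⌉₊, fun n₁ n₂ n₃ h21 h32 hn₀ => ?_⟩
  set N := ⌈(8 + δ) * (n₁ : ℝ)⌉₊ with hN
  have hn1 : (0 : ℝ) ≤ n₁ := by positivity
  have hNlow : (8 + δ) * (n₁ : ℝ) ≤ N := Nat.le_ceil _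
  have hNupp : (N : ℝ) < (8 + δ) * (n₁ : ℝ) + 1 := Nat.ceil_lt_add_one (by positivity)
  have hn1' : (1 : ℝ) ≤ n₁ := by exact_mod_cast (by omega : 1 ≤ n₁)
  have hNn : n₁ ≤ N := by
    have : (n₁ : ℝ) ≤ N := by nlinarith
    exact_mod_cast this
  have hδn : 8 ≤ δ * n₁ := by
    have : 8 / δ ≤ n₁ := (Nat.le_ceil _).trans (by exact_mod_cast (by omega : ⌈8 / δ⌉₊ ≤ n₁))
    rwa [div_le_iff₀ hδ0, mul_comm] at this
  refine hprob N (by omega) _ fun G hG c => ?_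
  by_contra! hno
  set L : Fin 3 → ℕ := ![2 * n₁ + 1, 2 * n₂ + 1, 2 * n₃ + 1] with hL
  have hLprop : ∀ i, L i % 2 = 1 ∧ K ≤ L i ∧ L i ≤ 2 * n₁ + 1 := by
    intro i
    fin_cases i <;> simp [L] <;> omega
  choose l r comp bip w hw2 hcomp hcov hbip hbip1 hsum hfew using fun i : Fin 3 =>
    hstruct (Fin N) (by rw [Fintype.card_fin]; omega) (G.colourGraph c i) (L i) (hLprop i).1
      (hLprop i).2.1 (fun u x hx hxl => hno i (hxl ▸ hasMonoCycle_of_isCycle_colourGraph G c i x hx))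
  simp only [Fintype.card_fin] at hsum hfew
  have hmiss := hG (fun v i => l i v) (fun x y => ∀ i, ¬ r i (x i) (y i)) (by
    have hsub : (Finset.univ.filter fun e : Fin N × Fin N =>
        (∀ i, ¬ r i (l i e.1) (l i e.2)) ∧ G.Adj e.1 e.2) ⊆
        Finset.univ.biUnion fun i => Finset.univ.filter fun e : Fin N × Fin N =>
          (G.colourGraph c i).Adj e.1 e.2 ∧ ¬ r i (l i e.1) (l i e.2) := by
      intro e he
      obtain ⟨h1, h2⟩ := (Finset.mem_filter.1 he).2
      rw [Finset.mem_biUnion]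
      exact ⟨c ⟨s(e.1, e.2), h2⟩, Finset.mem_univ _, Finset.mem_filter.2
        ⟨Finset.mem_univ _, ⟨h2, rfl⟩, h1 _⟩⟩
    have h1 := (Finset.card_le_card hsub).trans Finset.card_biUnion_le
    have h2 := (Nat.cast_le (α := ℝ)).2 h1
    rw [Nat.cast_sum] at h2
    refine le_trans (le_of_eq (by congr!)) (h2.trans ?_)
    refine (Finset.sum_le_card_nsmul _ _ _ fun i _ => hfew i).trans (le_of_eq ?_)
    rw [Finset.card_univ, Fintype.card_fin, nsmul_eq_mul, hη]
    push_cast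
    ring)
  have key := card_le_of_three_covers_of_few_missing (V := Fin N)
    (fun i u v => r i (l i u) (l i v)) (fun i u => comp i (l i u)) bip (fun i u => w i (l i u))
    (2 * n₁ + 1 + η * N) τ hτ0 (by positivity) (fun i u => hw2 i _)
    (fun i u v => hcomp i _ _) (fun i u v => hcov i _ _) (fun i u v => hbip i _ _)
    (fun i u => hbip1 i _) (fun i x hx => by
      have h1 : (L i : ℝ) ≤ 2 * n₁ + 1 := by exact_mod_cast (hLprop i).2.2
      have h2 := hsum i x hx
      refine le_trans ?_ (h2.trans (by linarith))
      convert le_rfl) (by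
      rw [Fintype.card_fin]
      convert hmiss)
  rw [Fintype.card_fin] at key
  have hN10 : (N : ℝ) ≤ 10 * n₁ := by nlinarith
  have h1 : η * N ≤ τ * (10 * n₁) := by gcongr
  have h2 : τ * N ≤ τ * (10 * n₁) := by gcongr
  rw [hτ] at h1 h2 key
  nlinarith
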